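/- arXiv:2602.19256 — 2 statements merged into one kernel-verified Lean document; each statement's English description precedes it below -/
import Mathlib

section
/- Let X be a local dendrite and f : X → X a homeomorphism without wandering points. Then the induced map 2^f on the hyperspace of nonempty closed subsets of X satisfies h_pol(2^f) = 0. -/
open Filter Topology TopologicalSpace Set
open scoped ENNReal NNReal

variable {X : Type*}

/-- The dynamical (Bowen) distance `d_n^f(x,y) = max_{0 ≤ k ≤ n-1} d(f^k x, f^k y)`. -/
noncomputable def dynDist [PseudoMetricSpace X] (f : X → X) (n : ℕ) (x y : X) : ℝ :=
  (((Finset.range n).sup fun k => nndist (f^[k] x) (f^[k] y) : ℝ≥0) : ℝ)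

/-- `E` is `(n, ε)`-separated for `f`: distinct points of `E` are at `d_n^f`-distance `≥ ε`. -/
def IsDynSeparated [PseudoMetricSpace X] (f : X → X) (n : ℕ) (ε : ℝ) (E : Set X) : Prop :=
  ∀ x ∈ E, ∀ y ∈ E, x ≠ y → ε ≤ dynDist f n x y

/-- `sep(n, ε)`: the maximal cardinality of a finite `(n, ε)`-separated set. -/
noncomputable def sepCount [PseudoMetricSpace X] (f : X → X) (n : ℕ) (ε : ℝ) : ℕ∞ :=
  ⨆ (E : Finset X) (_ : IsDynSeparated f n ε (E : Set X)), (E.card : ℕ∞)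

/-- `limsup_{n → ∞} log (u n) / log n`, valued in `[0, ∞]`. -/
noncomputable def polGrowth (u : ℕ → ℕ∞) : ℝ≥0∞ :=
  Filter.atTop.limsup fun n =>
    if u n = ⊤ then ⊤ else ENNReal.ofReal (Real.log ((u n).toNat : ℝ) / Real.log n)

/-- Polynomial entropy: `lim_{ε → 0⁺} limsup_{n → ∞} log sep(n,ε) / log n`; since the inner
quantity is antitone in `ε`, the limit as `ε → 0⁺` equals the supremum over `ε > 0`. -/
noncomputable def hpol [PseudoMetricSpace X] (f : X → X) : ℝ≥0∞ :=
  ⨆ (ε : ℝ) (_ : 0 < ε), polGrowth fun n => sepCount f n ε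

/-- A wandering point: some open neighbourhood `U` of `p` satisfies `f^n(U) ∩ U = ∅` for all
`n ≥ 1`. -/
def IsWanderingPoint [TopologicalSpace X] (f : X → X) (p : X) : Prop :=
  ∃ U : Set X, IsOpen U ∧ p ∈ U ∧ ∀ n : ℕ, 1 ≤ n → f^[n] '' U ∩ U = ∅

/-- A subset `D` is a dendrite: a nonempty compact connected, locally connected subspace
containing no subspace homeomorphic to the circle. -/
def IsDendriteSet [TopologicalSpace X] (D : Set X) : Prop :=
  IsCompact D ∧ IsConnected D ∧ LocallyConnectedSpace D ∧
    ¬ ∃ S : Set D, Nonempty (S ≃ₜ (Metric.sphere (0 : ℂ) 1))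

/-- A local dendrite: every point has a neighbourhood which is a dendrite. (The requirement
that `X` be a continuum is imposed via instance arguments.) -/
def IsLocalDendrite (X : Type*) [TopologicalSpace X] : Prop :=
  ∀ x : X, ∃ D : Set X, D ∈ nhds x ∧ IsDendriteSet D

/-- The induced map `2^f : A ↦ f(A)` on the hyperspace of nonempty closed subsets of a compact
metric space (equivalently, nonempty compact subsets), with the Hausdorff metric. -/
noncomputable def hyperMap [TopologicalSpace X] (f : X → X) (hf : Continuous f) :
    NonemptyCompacts X → NonemptyCompacts X :=
  fun A => ⟨⟨f '' (A : Set X), A.isCompact.image hf⟩, A.nonempty.image f⟩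

/-- Concatenations of finitely many short paths in `E`, each with endpoints in the image of `ι` and
staying within `δ` of both of its endpoints. -/
inductive IsChainPath {X E : Type*} [MetricSpace X] [NormedAddCommGroup E] (ι : X → E) (δ : ℝ) :
    ∀ {x y : X}, Path (ι x) (ι y) → Prop
  | short {x y : X} (h : dist x y < δ) (p : Path (ι x) (ι y))
      (hp : ∀ t, dist (p t) (ι x) < δ ∧ dist (p t) (ι y) < δ) : IsChainPath ι δ p
  | trans {x y z : X} (p : Path (ι x) (ι y)) (q : Path (ι y) (ι z)) :
      IsChainPath ι δ p → IsChainPath ι δ q → IsChainPath ι δ (p.trans q)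

theorem IsChainPath.exists_dist_lt {X E : Type*} [MetricSpace X] [NormedAddCommGroup E]
    {ι : X → E} {δ : ℝ} {x y : X} {p : Path (ι x) (ι y)}
    (hp : IsChainPath ι δ p) (t : unitInterval) : ∃ z, dist (p t) (ι z) < δ := by
  induction hp generalizing t with
  | @short x y h p hp => exact ⟨x, (hp t).1⟩
  | trans p q hp hq ihp ihq =>
    rw [Path.trans_apply]
    split_ifs
    exacts [ihp _, ihq _]

section ChainPath

variable {X E : Type*} [MetricSpace X] [NormedAddCommGroup E] [NormedSpace ℝ E] {ι : X → E}

theorem exists_isChainPath_of_dist_lt (hι : Isometry ι) {δ : ℝ} {x y : X}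
    (h : dist x y < δ) : ∃ p : Path (ι x) (ι y), IsChainPath ι δ p ∧
      ∀ t, dist (p t) (ι x) < δ := by
  have key : ∀ t : unitInterval, dist ((1 - (t : ℝ)) • ι x + (t : ℝ) • ι y) (ι x) < δ ∧
      dist ((1 - (t : ℝ)) • ι x + (t : ℝ) • ι y) (ι y) < δ := by
    intro t
    have h' : ‖ι y - ι x‖ < δ := by rwa [← dist_eq_norm, hι.dist_eq, dist_comm]
    have ht0 := t.2.1
    have ht1 := t.2.2
    constructor
    · have : (1 - (t : ℝ)) • ι x + (t : ℝ) • ι y - ι x = (t : ℝ) • (ι y - ι x) := by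
        module
      rw [dist_eq_norm, this, norm_smul, Real.norm_of_nonneg ht0]
      nlinarith [norm_nonneg (ι y - ι x)]
    · have : (1 - (t : ℝ)) • ι x + (t : ℝ) • ι y - ι y = (1 - (t : ℝ)) • (ι x - ι y) := by
        module
      rw [dist_eq_norm, this, norm_smul, Real.norm_of_nonneg (by linarith), norm_sub_rev]
      nlinarith [norm_nonneg (ι y - ι x)]
  let p : Path (ι x) (ι y) :=
    { toFun := fun t => (1 - (t : ℝ)) • ι x + (t : ℝ) • ι y
      continuous_toFun := by fun_prop
      source' := by simp
      target' := by simp }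
  exact ⟨p, .short h p key, fun t => (key t).1⟩

theorem exists_isChainPath_of_isPreconnected (hι : Isometry ι) {δ : ℝ} (hδ : 0 < δ) {C : Set X}
    (hC : IsPreconnected C) {x y : X} (hx : x ∈ C) (hy : y ∈ C) :
    ∃ p : Path (ι x) (ι y), IsChainPath ι δ p ∧ ∀ t, ∃ z ∈ C, dist (p t) (ι z) < δ := by
  refine hC.induction₂' (fun x y => ∃ p : Path (ι x) (ι y), IsChainPath ι δ p ∧
    ∀ t, ∃ z ∈ C, dist (p t) (ι z) < δ) ?_ ?_ hx hy
  · intro x hx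
    filter_upwards [mem_nhdsWithin_of_mem_nhds (Metric.ball_mem_nhds x hδ),
      self_mem_nhdsWithin] with y hy hyC
    obtain ⟨p, hp, hp'⟩ := exists_isChainPath_of_dist_lt hι (Metric.mem_ball'.1 hy)
    obtain ⟨q, hq, hq'⟩ := exists_isChainPath_of_dist_lt hι (Metric.mem_ball.1 hy)
    exact ⟨⟨p, hp, fun t => ⟨x, hx, hp' t⟩⟩, ⟨q, hq, fun t => ⟨y, hyC, hq' t⟩⟩⟩
  · rintro x y z - - - ⟨p, hp, hp'⟩ ⟨q, hq, hq'⟩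
    refine ⟨p.trans q, hp.trans _ _ hq, fun t => ?_⟩
    rw [Path.trans_apply]
    split_ifs
    exacts [hp' _, hq' _]

theorem IsChainPath.exists_refinement (hι : Isometry ι) {δ δ' ε : ℝ} (hδ' : 0 < δ')
    (hδε : δ ≤ ε) (hδε' : δ' ≤ ε)
    (hC : ∀ x y : X, dist x y < δ → ∃ C, IsPreconnected C ∧ x ∈ C ∧ y ∈ C ∧ C ⊆ Metric.ball x ε)
    {x y : X} {p : Path (ι x) (ι y)} (hp : IsChainPath ι δ p) :
    ∃ q : Path (ι x) (ι y), IsChainPath ι δ' q ∧ ∀ t, dist (p t) (q t) ≤ 3 * ε := by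
  induction hp with
  | @short x y h p hp =>
    obtain ⟨C, hCc, hx, hy, hCb⟩ := hC x y h
    obtain ⟨q, hq, hq'⟩ := exists_isChainPath_of_isPreconnected hι hδ' hCc hx hy
    refine ⟨q, hq, fun t => ?_⟩
    obtain ⟨z, hz, hzt⟩ := hq' t
    have h1 := (hp t).1
    have h2 : dist (ι x) (ι z) < ε := by
      rw [hι.dist_eq, dist_comm]
      exact hCb hz
    have := dist_triangle4 (p t) (ι x) (ι z) (q t)
    rw [dist_comm (ι z)] at this
    linarith
  | trans p q hp hq ihp ihq =>
    obtain ⟨p', hp', h1⟩ := ihp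
    obtain ⟨q', hq', h2⟩ := ihq
    refine ⟨p'.trans q', hp'.trans _ _ hq', fun t => ?_⟩
    rw [Path.trans_apply, Path.trans_apply]
    split_ifs
    exacts [h1 _, h2 _]

theorem exists_path_of_forall_isPreconnected [CompactSpace X] [CompleteSpace E]
    (hι : Isometry ι) {δ : ℕ → ℝ} {ε : ℝ} (hδ : ∀ n, 0 < δ n) (hδε : ∀ n, δ n ≤ ε / 2 / 2 ^ n)
    (hC : ∀ n, ∀ x y : X, dist x y < δ n →
      ∃ C, IsPreconnected C ∧ x ∈ C ∧ y ∈ C ∧ C ⊆ Metric.ball x (ε / 2 / 2 ^ n))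
    {x y : X} (hxy : dist x y < δ 0) : ∃ p : Path x y, ∀ t, dist (p t) x ≤ 4 * ε := by
  have hε : 0 < ε := by
    have := (hδ 0).trans_le (hδε 0)
    simp at this
    linarith
  obtain ⟨p₀, hp₀, hp₀'⟩ := exists_isChainPath_of_dist_lt hι hxy
  have step : ∀ n (p : {p : Path (ι x) (ι y) // IsChainPath ι (δ n) p}),
      ∃ q : {q : Path (ι x) (ι y) // IsChainPath ι (δ (n + 1)) q},
        ∀ t, dist (p.1 t) (q.1 t) ≤ 3 * (ε / 2 / 2 ^ n) := by
    rintro n ⟨p, hp⟩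
    have : δ (n + 1) ≤ ε / 2 / 2 ^ n := by
      refine (hδε (n + 1)).trans ?_
      gcongr <;> norm_num
    obtain ⟨q, hq, h⟩ := hp.exists_refinement hι (hδ (n + 1)) (hδε n) this (hC n)
    exact ⟨⟨q, hq⟩, h⟩
  choose next hnext using step
  let P : ∀ n, {p : Path (ι x) (ι y) // IsChainPath ι (δ n) p} :=
    fun n => Nat.rec ⟨p₀, hp₀⟩ (fun n p => next n p) n
  have hP : ∀ n t, dist ((P n).1 t) ((P (n + 1)).1 t) ≤ 3 * ε / 2 / 2 ^ n := fun n t =>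
    (hnext n (P n) t).trans_eq (by ring)
  let g : ℕ → C(unitInterval, E) := fun n => (P n).1.toContinuousMap
  have hg : ∀ n, dist (g n) (g (n + 1)) ≤ 3 * ε / 2 / 2 ^ n := fun n =>
    (ContinuousMap.dist_le (by positivity)).2 (hP n)
  obtain ⟨q, hq⟩ := cauchySeq_tendsto_of_complete (cauchySeq_of_le_geometric_two hg)
  have hqt : ∀ t, Tendsto (fun n => (P n).1 t) atTop (𝓝 (q t)) := fun t =>
    ((continuous_eval_const t).tendsto q).comp hq
  have hδ0 : Tendsto δ atTop (𝓝 0) := by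
    refine squeeze_zero (fun n => (hδ n).le) hδε ?_
    have := (tendsto_pow_atTop_nhds_zero_of_lt_one (r := (1 / 2 : ℝ)) (by norm_num)
      (by norm_num)).const_mul (ε / 2)
    simpa [div_eq_mul_inv] using this
  have hcl : IsClosed (range ι) := (isCompact_range hι.continuous).isClosed
  have hmem : ∀ t, q t ∈ range ι := by
    intro t
    rw [← hcl.closure_eq, Metric.mem_closure_iff]
    intro η hη
    have h1 := (hqt t).eventually (Metric.ball_mem_nhds _ (half_pos hη))
    have h2 := hδ0.eventually (gt_mem_nhds (half_pos hη))
    obtain ⟨n, hn1, hn2⟩ := (h1.and h2).exists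
    obtain ⟨z, hz⟩ := (P n).2.exists_dist_lt t
    refine ⟨ι z, ⟨z, rfl⟩, ?_⟩
    have := dist_triangle_left (q t) (ι z) ((P n).1 t)
    have h3 := Metric.mem_ball.1 hn1
    linarith
  choose r hr using hmem
  have hr0 : q 0 = ι x := tendsto_nhds_unique (hqt 0) (by simp)
  have hr1 : q 1 = ι y := tendsto_nhds_unique (hqt 1) (by simp)
  have hrc : Continuous r := by
    rw [hι.isEmbedding.continuous_iff]
    exact (map_continuous q).congr fun t => (hr t).symm
  refine ⟨⟨⟨r, hrc⟩, hι.injective ((hr 0).trans hr0), hι.injective ((hr 1).trans hr1)⟩,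
    fun t => ?_⟩
  have h1 := dist_le_of_le_geometric_two_of_tendsto₀ (f := fun n => (P n).1 t) (C := 3 * ε)
    (fun n => hP n t) (hqt t)
  have h2 : dist ((P 0).1 t) (ι x) < δ 0 := hp₀' t
  have h3 := hδε 0
  change dist (r t) x ≤ _
  rw [← hι.dist_eq, hr]
  have := dist_triangle_left (q t) (ι x) ((P 0).1 t)
  simp at h3
  linarith

end ChainPath

section Peano

variable {X : Type*} [MetricSpace X] [CompactSpace X] [LocallyConnectedSpace X]

/-- A compact locally connected metric space is uniformly locally connected. -/
theorem exists_forall_dist_lt_isPreconnected {ε : ℝ} (hε : 0 < ε) :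
    ∃ δ > 0, ∀ x y : X, dist x y < δ →
      ∃ C, IsPreconnected C ∧ x ∈ C ∧ y ∈ C ∧ C ⊆ Metric.ball x ε := by
  obtain ⟨δ, hδ, h⟩ := lebesgue_number_lemma_of_metric (isCompact_univ (X := X))
    (c := fun z => connectedComponentIn (Metric.ball z (ε / 2)) z)
    (fun z => Metric.isOpen_ball.connectedComponentIn)
    (fun z _ => mem_iUnion.2 ⟨z, mem_connectedComponentIn (Metric.mem_ball_self (half_pos hε))⟩)
  refine ⟨δ, hδ, fun x y hxy => ?_⟩
  obtain ⟨z, hz⟩ := h x (mem_univ x)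
  refine ⟨_, isPreconnected_connectedComponentIn, hz (Metric.mem_ball_self hδ),
    hz (Metric.mem_ball'.2 hxy), fun w hw => ?_⟩
  have h1 := Metric.mem_ball.1 (connectedComponentIn_subset _ _ hw)
  have h2 := Metric.mem_ball.1 (connectedComponentIn_subset _ _ (hz (Metric.mem_ball_self hδ)))
  have := dist_triangle_right w x z
  rw [Metric.mem_ball]
  linarith

/-- In a compact locally connected metric space, nearby points are joined by small paths. -/
theorem exists_forall_dist_lt_joinedIn {ε : ℝ} (hε : 0 < ε) :
    ∃ δ > 0, ∀ x y : X, dist x y < δ → JoinedIn (Metric.ball x ε) x y := by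
  have : ∀ n : ℕ, ∃ δ > 0, δ ≤ ε / 8 / 2 / 2 ^ n ∧ ∀ x y : X, dist x y < δ →
      ∃ C, IsPreconnected C ∧ x ∈ C ∧ y ∈ C ∧ C ⊆ Metric.ball x (ε / 8 / 2 / 2 ^ n) := by
    intro n
    obtain ⟨δ, hδ, h⟩ := exists_forall_dist_lt_isPreconnected (X := X)
      (ε := ε / 8 / 2 / 2 ^ n) (by positivity)
    exact ⟨min δ (ε / 8 / 2 / 2 ^ n), by positivity, min_le_right _ _,
      fun x y hxy => h x y (hxy.trans_le (min_le_left _ _))⟩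
  choose δ hδ hδε hC using this
  refine ⟨δ 0, hδ 0, fun x y hxy => ?_⟩
  have : Nonempty X := ⟨x⟩
  obtain ⟨p, hp⟩ := exists_path_of_forall_isPreconnected (kuratowskiEmbedding.isometry X)
    hδ hδε hC hxy
  refine ⟨p, fun t => ?_⟩
  rw [Metric.mem_ball]
  linarith [hp t]

/-- Mazurkiewicz: compact locally connected metric spaces are locally path connected. -/
theorem locallyPathConnectedSpace_of_locallyConnectedSpace : LocallyPathConnectedSpace X where
  path_connected_basis x := ⟨fun t => ⟨fun ht => by
    obtain ⟨ε, hε, hb⟩ := Metric.mem_nhds_iff.1 ht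
    obtain ⟨δ, hδ, h⟩ := exists_forall_dist_lt_joinedIn (X := X) hε
    exact ⟨pathComponentIn (Metric.ball x ε) x,
      ⟨Filter.mem_of_superset (Metric.ball_mem_nhds x hδ) fun y hy => h x y (Metric.mem_ball'.1 hy),
        isPathConnected_pathComponentIn (Metric.mem_ball_self hε)⟩,
      pathComponentIn_subset.trans hb⟩,
    fun ⟨_, hs, hst⟩ => Filter.mem_of_superset hs.1 hst⟩⟩

end Peano

section Arc

variable {Y : Type*} [MetricSpace Y]

/-- `K` is a closed set of parameters containing both endpoints such that the path `γ` takes the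
same value at the two ends of every gap of `K`. -/
structure IsLoopErasure (γ : unitInterval → Y) (K : Set unitInterval) : Prop where
  isClosed : IsClosed K
  zero_mem : 0 ∈ K
  one_mem : 1 ∈ K
  eq_of_gap : ∀ a ∈ K, ∀ b ∈ K, a < b → Disjoint (Ioo a b) K → γ a = γ b

theorem IsLoopErasure.sInter {γ : unitInterval → Y} (hγ : Continuous γ)
    {c : Set (Set unitInterval)} (hc : ∀ K ∈ c, IsLoopErasure γ K) (hchain : IsChain (· ⊆ ·) c)
    (hne : c.Nonempty) : IsLoopErasure γ (⋂₀ c) where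
  isClosed := isClosed_sInter fun K hK => (hc K hK).isClosed
  zero_mem := fun K hK => (hc K hK).zero_mem
  one_mem := fun K hK => (hc K hK).one_mem
  eq_of_gap := by
    intro a ha b hb hab hd
    have key : ∀ a' ∈ Ioo a b, ∀ b' ∈ Ioo a b, a' < b' →
        ∃ s ∈ Icc a a', ∃ t ∈ Icc b' b, γ s = γ t := by
      intro a' ha' b' hb' hab'
      obtain ⟨K, hK, hKd⟩ : ∃ K ∈ c, Icc a' b' ∩ K = ∅ := by
        by_contra! hcon
        have : Nonempty c := hne.to_subtype
        have := IsCompact.nonempty_iInter_of_directed_nonempty_isCompact_isClosed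
          (fun K : c => Icc a' b' ∩ K.1) ?_ (fun K => hcon K.1 K.2)
          (fun K => isCompact_Icc.inter_right (hc K.1 K.2).isClosed)
          (fun K => isClosed_Icc.inter (hc K.1 K.2).isClosed)
        · obtain ⟨x, hx⟩ := this
          rw [mem_iInter] at hx
          obtain ⟨K₀, hK₀⟩ := hne
          have hx' := (hx ⟨K₀, hK₀⟩).1
          exact disjoint_left.1 hd ⟨ha'.1.trans_le hx'.1, hx'.2.trans_lt hb'.2⟩
            (mem_sInter.2 fun K hK => (hx ⟨K, hK⟩).2)
        · rintro ⟨K, hK⟩ ⟨L, hL⟩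
          rcases hchain.total hK hL with h | h
          · exact ⟨⟨K, hK⟩, subset_rfl, inter_subset_inter_right _ h⟩
          · exact ⟨⟨L, hL⟩, inter_subset_inter_right _ h, subset_rfl⟩
      have hKc := (hc K hK).isClosed
      obtain ⟨s, hs⟩ := (isCompact_Icc.inter_right hKc).exists_isGreatest
        (⟨a, ⟨le_rfl, ha'.1.le⟩, ha K hK⟩ : (Icc a a' ∩ K).Nonempty)
      obtain ⟨t, ht⟩ := (isCompact_Icc.inter_right hKc).exists_isLeast
        (⟨b, ⟨hb'.2.le, le_rfl⟩, hb K hK⟩ : (Icc b' b ∩ K).Nonempty)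
      refine ⟨s, hs.1.1, t, ht.1.1, (hc K hK).eq_of_gap s hs.1.2 t ht.1.2
        (hs.1.1.2.trans_lt (hab'.trans_le ht.1.1.1)) (disjoint_left.2 fun x hx hxK => ?_)⟩
      rcases le_or_gt x a' with h1 | h1
      · exact hx.1.not_ge (hs.2 ⟨⟨hs.1.1.1.trans hx.1.le, h1⟩, hxK⟩)
      rcases le_or_gt b' x with h2 | h2
      · exact hx.2.not_ge (ht.2 ⟨⟨h2, hx.2.le.trans ht.1.1.2⟩, hxK⟩)
      exact (hKd.subset ⟨⟨h1.le, h2.le⟩, hxK⟩ : x ∈ (∅ : Set unitInterval))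
    refine eq_of_forall_dist_le fun ε hε => ?_
    obtain ⟨a', ha', hsa⟩ : ∃ a' ∈ Ioo a b, ∀ s ∈ Icc a a', dist (γ s) (γ a) < ε / 2 := by
      have h1 := hγ.continuousAt.eventually (Metric.ball_mem_nhds (γ a) (half_pos hε))
      obtain ⟨u, hu, hu'⟩ := (mem_nhdsGE_iff_exists_Ico_subset' hab).1 (mem_nhdsWithin_of_mem_nhds h1)
      obtain ⟨a', h2, h3⟩ := exists_between (lt_min hab hu)
      exact ⟨a', ⟨h2, h3.trans_le (min_le_left _ _)⟩,
        fun s hs => hu' ⟨hs.1, hs.2.trans_lt (h3.trans_le (min_le_right _ _))⟩⟩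
    obtain ⟨b', hb', hsb⟩ : ∃ b' ∈ Ioo a' b, ∀ s ∈ Icc b' b, dist (γ s) (γ b) < ε / 2 := by
      have h1 := hγ.continuousAt.eventually (Metric.ball_mem_nhds (γ b) (half_pos hε))
      obtain ⟨u, hu, hu'⟩ := (mem_nhdsLE_iff_exists_Ioc_subset' ha'.2).1
        (mem_nhdsWithin_of_mem_nhds h1)
      obtain ⟨b', h2, h3⟩ := exists_between (max_lt ha'.2 hu)
      exact ⟨b', ⟨(le_max_left _ _).trans_lt h2, h3⟩,
        fun s hs => hu' ⟨((le_max_right _ _).trans_lt h2).trans_le hs.1, hs.2⟩⟩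
    obtain ⟨s, hs, t, ht, hst⟩ := key a' ha' b' ⟨ha'.1.trans hb'.1, hb'.2⟩ hb'.1
    have := dist_triangle_left (γ a) (γ b) (γ s)
    have h1 := hsa s hs
    have h2 := hsb t ht
    rw [← hst] at h2
    linarith

/-- Every path has a loop erasure on which the only coincidences are at the ends of gaps. -/
theorem exists_minimal_isLoopErasure {γ : unitInterval → Y} (hγ : Continuous γ) :
    ∃ K, IsLoopErasure γ K ∧
      ∀ a ∈ K, ∀ b ∈ K, a < b → γ a = γ b → Disjoint (Ioo a b) K := by
  obtain ⟨K, -, hK⟩ := zorn_superset_nonempty {K | IsLoopErasure γ K}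
    (fun c hc hchain hne => ⟨⋂₀ c, IsLoopErasure.sInter hγ hc hchain hne,
      fun s hs => sInter_subset_of_mem hs⟩) univ
    ⟨isClosed_univ, mem_univ _, mem_univ _, fun a _ b _ hab hd => by
      obtain ⟨x, hx⟩ := exists_between hab
      exact (disjoint_left.1 hd hx (mem_univ _)).elim⟩
  refine ⟨K, hK.prop, fun a ha b hb hab heq => ?_⟩
  have hL : IsLoopErasure γ (K \ Ioo a b) := by
    refine ⟨hK.prop.isClosed.sdiff isOpen_Ioo, ⟨hK.prop.zero_mem, fun h => ?_⟩,
      ⟨hK.prop.one_mem, fun h => ?_⟩, ?_⟩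
    · exact h.1.not_ge unitInterval.nonneg'
    · exact h.2.not_ge unitInterval.le_one'
    · rintro c ⟨hc, hc'⟩ d ⟨hd, hd'⟩ hcd hdisj
      have ha' : a ∈ K \ Ioo a b := ⟨ha, fun h => h.1.false⟩
      have hb' : b ∈ K \ Ioo a b := ⟨hb, fun h => h.2.false⟩
      have h1 : ¬ (c < a ∧ a < d) := fun h => disjoint_left.1 hdisj h ha'
      have h2 : ¬ (c < b ∧ b < d) := fun h => disjoint_left.1 hdisj h hb'
      by_cases h3 : c ≤ a ∧ b ≤ d
      · have h4 : c = a := by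
          by_contra h
          exact h1 ⟨lt_of_le_of_ne h3.1 h, hab.trans_le h3.2⟩
        have h5 : d = b := by
          by_contra h
          exact h2 ⟨h3.1.trans_lt hab, lt_of_le_of_ne h3.2 (Ne.symm h)⟩
        rw [h4, h5, heq]
      · refine hK.prop.eq_of_gap c hc d hd hcd (disjoint_left.2 fun x hx hxK => ?_)
        refine disjoint_left.1 hdisj hx ⟨hxK, fun hxab => ?_⟩
        simp only [mem_Ioo] at *
        grind
  have := hK.le_of_le hL sdiff_subset
  exact disjoint_left.2 fun x hx hxK => (this hxK).2 hx

/-- Every path can be replaced by a path with connected fibres. -/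
theorem exists_continuous_monotone_fibres {γ : unitInterval → Y} (hγ : Continuous γ) :
    ∃ γ' : unitInterval → Y, Continuous γ' ∧ γ' 0 = γ 0 ∧ γ' 1 = γ 1 ∧ range γ' ⊆ range γ ∧
      ∀ s t u, s ≤ t → t ≤ u → γ' s = γ' u → γ' t = γ' u := by
  obtain ⟨K, hK, hmin⟩ := exists_minimal_isLoopErasure hγ
  have hex : ∀ t, ∃ a, IsGreatest (Iic t ∩ K) a := fun t =>
    ((isClosed_Iic.inter hK.isClosed).isCompact).exists_isGreatest
      ⟨0, unitInterval.nonneg', hK.zero_mem⟩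
  have hex' : ∀ t, ∃ a, IsLeast (Ici t ∩ K) a := fun t =>
    ((isClosed_Ici.inter hK.isClosed).isCompact).exists_isLeast
      ⟨1, unitInterval.le_one', hK.one_mem⟩
  choose a ha using hex
  choose b hb using hex'
  have hmono : Monotone a := fun s t hst => (ha t).2 ⟨(ha s).1.1.trans hst, (ha s).1.2⟩
  have hab : ∀ t, γ (a t) = γ (b t) := by
    intro t
    have h1 : a t ≤ t := (ha t).1.1
    have h2 : t ≤ b t := (hb t).1.1
    rcases (h1.trans h2).eq_or_lt with h | h
    · rw [h]
    · refine hK.eq_of_gap _ (ha t).1.2 _ (hb t).1.2 h (disjoint_left.2 fun x hx hxK => ?_)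
      rcases le_total x t with h | h
      · exact hx.1.not_ge ((ha t).2 ⟨h, hxK⟩)
      · exact hx.2.not_ge ((hb t).2 ⟨h, hxK⟩)
  refine ⟨γ ∘ a, ?_, ?_, ?_, range_comp_subset_range _ _, ?_⟩
  · rw [Metric.continuous_iff']
    have huc := CompactSpace.uniformContinuous_of_continuous hγ
    rw [Metric.uniformContinuous_iff] at huc
    have key : ∀ s t, s ≤ t → ∃ s' ∈ Icc s t, ∃ t' ∈ Icc s t, γ (a s) = γ s' ∧ γ (a t) = γ t' ∨
        γ (a s) = γ (a t) := by
      intro s t hst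
      rcases le_or_gt (a t) s with h | h
      · have : a s = a t := le_antisymm (hmono hst) ((ha s).2 ⟨h, (ha t).1.2⟩)
        exact ⟨s, ⟨le_rfl, hst⟩, s, ⟨le_rfl, hst⟩, Or.inr (by rw [this])⟩
      · have h1 : b s ≤ a t := (hb s).2 ⟨h.le, (ha t).1.2⟩
        exact ⟨b s, ⟨(hb s).1.1, h1.trans (ha t).1.1⟩, a t, ⟨h.le, (ha t).1.1⟩,
          Or.inl ⟨hab s, rfl⟩⟩
    have key' : ∀ ε > 0, ∃ δ > 0, ∀ s t, s ≤ t → dist s t < δ → dist (γ (a s)) (γ (a t)) < ε := by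
      intro ε hε
      obtain ⟨δ, hδ, h⟩ := huc ε hε
      refine ⟨δ, hδ, fun s t hst hd => ?_⟩
      obtain ⟨s', hs', t', ht', ⟨h1, h2⟩ | h1⟩ := key s t hst
      · rw [h1, h2]
        refine h (lt_of_le_of_lt ?_ hd)
        exact Real.dist_le_of_mem_uIcc (Icc_subset_uIcc ⟨hs'.1, hs'.2⟩)
          (Icc_subset_uIcc ⟨ht'.1, ht'.2⟩)
      · rw [h1, dist_self]
        exact hε
    intro t ε hε
    obtain ⟨δ, hδ, h⟩ := key' ε hε
    filter_upwards [Metric.ball_mem_nhds t hδ] with s hs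
    rcases le_total s t with hst | hst
    · exact h s t hst hs
    · simp only [Function.comp]
      rw [dist_comm]
      exact h t s hst (Metric.mem_ball'.1 hs)
  · have : a 0 = 0 := le_antisymm (ha 0).1.1 unitInterval.nonneg'
    simp [this]
  · have : a 1 = 1 := le_antisymm (ha 1).1.1 ((ha 1).2 ⟨mem_Iic.2 le_rfl, hK.one_mem⟩)
    simp [this]
  · intro s t u hst htu heq
    have h1 := hmono hst
    have h2 := hmono htu
    simp only [Function.comp] at *
    rcases (h1.trans h2).eq_or_lt with h | h
    · rw [le_antisymm h2 (h.symm.le.trans h1)]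
    · have hd := hmin _ (ha s).1.2 _ (ha u).1.2 h heq
      rcases h1.eq_or_lt with h3 | h3
      · rw [← h3, heq]
      rcases h2.eq_or_lt with h4 | h4
      · rw [h4]
      exact (disjoint_left.1 hd ⟨h3, h4⟩ (ha t).1.2).elim

end Arc

section Parametrization

variable {Y : Type*} [MetricSpace Y]

/-- The largest distance, truncated at `1`, of a point of `γ [0, t]` to `γ [0, q]`. -/
noncomputable def maxExcursion (γ : unitInterval → Y) (q t : unitInterval) : ℝ :=
  sSup ((fun s => min 1 (Metric.infDist (γ (min t s)) (γ '' Icc 0 q))) '' univ)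

theorem continuous_maxExcursion {γ : unitInterval → Y} (hγ : Continuous γ) (q : unitInterval) :
    Continuous (maxExcursion γ q) := by
  refine IsCompact.continuous_sSup isCompact_univ ?_
  have := Metric.continuous_infDist_pt (γ '' Icc 0 q)
  fun_prop

theorem bddAbove_maxExcursion (γ : unitInterval → Y) (q t : unitInterval) :
    BddAbove ((fun s => min 1 (Metric.infDist (γ (min t s)) (γ '' Icc 0 q))) '' univ) :=
  ⟨1, by rintro _ ⟨s, -, rfl⟩; exact min_le_left _ _⟩

theorem maxExcursion_le_of {γ : unitInterval → Y} {q t : unitInterval} {c : ℝ}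
    (h : ∀ s ≤ t, min 1 (Metric.infDist (γ s) (γ '' Icc 0 q)) ≤ c) : maxExcursion γ q t ≤ c := by
  refine csSup_le (univ_nonempty.image _) ?_
  rintro _ ⟨s, -, rfl⟩
  exact h _ (min_le_left _ _)

theorem le_maxExcursion {γ : unitInterval → Y} {q s t : unitInterval} (h : s ≤ t) :
    min 1 (Metric.infDist (γ s) (γ '' Icc 0 q)) ≤ maxExcursion γ q t :=
  le_csSup (bddAbove_maxExcursion γ q t) ⟨s, mem_univ _, by simp [min_eq_right h]⟩

theorem maxExcursion_nonneg (γ : unitInterval → Y) (q t : unitInterval) :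
    0 ≤ maxExcursion γ q t :=
  (le_min zero_le_one Metric.infDist_nonneg).trans (le_maxExcursion le_rfl)

theorem monotone_maxExcursion (γ : unitInterval → Y) (q : unitInterval) :
    Monotone (maxExcursion γ q) :=
  fun _ _ hst => maxExcursion_le_of fun _ hr => le_maxExcursion (hr.trans hst)

theorem maxExcursion_le_one (γ : unitInterval → Y) (q t : unitInterval) :
    maxExcursion γ q t ≤ 1 :=
  maxExcursion_le_of fun _ _ => min_le_left _ _

/-- A path with connected fibres factors through a monotone continuous function whose fibres are
the same. -/
theorem exists_monotone_parameter {γ : unitInterval → Y} (hγ : Continuous γ)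
    (hfib : ∀ s t u, s ≤ t → t ≤ u → γ s = γ u → γ t = γ u) :
    ∃ w : unitInterval → ℝ, Continuous w ∧ Monotone w ∧ ∀ s t, w s = w t ↔ γ s = γ t := by
  let q : ℕ → unitInterval := denseSeq unitInterval
  have hsum : Summable fun n : ℕ => (1 / 2 : ℝ) ^ n := summable_geometric_two
  have hbd : ∀ n t, ‖(1 / 2 : ℝ) ^ n * maxExcursion γ (q n) t‖ ≤ (1 / 2 : ℝ) ^ n := fun n t => by
    rw [Real.norm_of_nonneg (mul_nonneg (by positivity) (maxExcursion_nonneg _ _ _))]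
    exact mul_le_of_le_one_right (by positivity) (maxExcursion_le_one _ _ _)
  have hs : ∀ t, Summable fun n => (1 / 2 : ℝ) ^ n * maxExcursion γ (q n) t := fun t =>
    Summable.of_norm_bounded hsum fun n => hbd n t
  have hmono : Monotone fun t => ∑' n, (1 / 2 : ℝ) ^ n * maxExcursion γ (q n) t := fun s t hst =>
    (hs s).tsum_le_tsum (fun n => mul_le_mul_of_nonneg_left (monotone_maxExcursion _ _ hst)
      (by positivity)) (hs t)
  have key : ∀ s t, s ≤ t → ((∑' n, (1 / 2 : ℝ) ^ n * maxExcursion γ (q n) s) =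
      (∑' n, (1 / 2 : ℝ) ^ n * maxExcursion γ (q n) t) ↔ γ s = γ t) := by
    intro s t hst
    constructor
    · intro heq
      by_contra hne
      obtain ⟨t₁, ht₁⟩ := (isCompact_Icc.inter_right
        (isClosed_singleton.preimage hγ : IsClosed (γ ⁻¹' {γ t}))).exists_isLeast
        (⟨t, ⟨hst, le_rfl⟩, rfl⟩ : (Icc s t ∩ γ ⁻¹' {γ t}).Nonempty)
      have hγt : γ t₁ = γ t := ht₁.1.2
      have hst₁ : s < t₁ := lt_of_le_of_ne ht₁.1.1.1 (by rintro rfl; exact hne hγt)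
      obtain ⟨n, hn⟩ : ∃ n, q n ∈ Ioo s t₁ := (denseRange_denseSeq unitInterval).exists_mem_open
        isOpen_Ioo (nonempty_Ioo.2 hst₁)
      refine heq.not_lt ((hs s).tsum_lt_tsum (i := n) (fun m => mul_le_mul_of_nonneg_left
        (monotone_maxExcursion _ _ hst) (by positivity)) ?_ (hs t))
      refine mul_lt_mul_of_pos_left ?_ (by positivity)
      have h0 : maxExcursion γ (q n) s ≤ 0 := by
        refine maxExcursion_le_of fun r hr => ?_
        rw [Metric.infDist_zero_of_mem (mem_image_of_mem γ
          (show r ∈ Icc 0 (q n) from ⟨unitInterval.nonneg', hr.trans hn.1.le⟩))]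
        simp
      refine h0.trans_lt (lt_of_lt_of_le (lt_min one_pos ?_) (le_maxExcursion ht₁.1.1.2))
      have hcl : IsClosed (γ '' Icc 0 (q n)) := (isCompact_Icc.image hγ).isClosed
      refine (hcl.notMem_iff_infDist_pos ⟨γ 0, 0,
        ⟨le_rfl, unitInterval.nonneg'⟩, rfl⟩).1
        ?_
      rintro ⟨r, hr, hrt⟩
      have h1 : γ (max r s) = γ t₁ := hfib r _ t₁ (le_max_left _ _)
        (max_le (hr.2.trans hn.2.le) hst₁.le) hrt
      have h2 : max r s ≤ q n := max_le hr.2 hn.1.le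
      exact (h2.trans_lt hn.2).not_ge (ht₁.2 ⟨⟨le_max_right _ _, h2.trans (hn.2.le.trans ht₁.1.1.2)⟩,
        h1.trans hγt⟩)
    · intro heq
      refine tsum_congr fun n => ?_
      congr 1
      refine le_antisymm (monotone_maxExcursion _ _ hst) (maxExcursion_le_of fun r hr => ?_)
      rcases le_total r s with h | h
      · exact le_maxExcursion h
      · rw [hfib s r t h hr heq, ← heq]
        exact le_maxExcursion le_rfl
  refine ⟨fun t => ∑' n, (1 / 2 : ℝ) ^ n * maxExcursion γ (q n) t,
    continuous_tsum (fun n => continuous_const.mul (continuous_maxExcursion hγ _)) hsum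
      (fun n t => hbd n t), hmono, fun s t => ?_⟩
  rcases le_total s t with h | h
  · exact key s t h
  · rw [eq_comm, key t s h, eq_comm]

/-- A path between distinct points contains an arc between these points. -/
theorem exists_arc_of_path {γ : unitInterval → Y} (hγ : Continuous γ) (hne : γ 0 ≠ γ 1) :
    ∃ β : ℝ → Y, Continuous β ∧ β 0 = γ 0 ∧ β 1 = γ 1 ∧ InjOn β (Icc 0 1) ∧
      β '' Icc 0 1 ⊆ range γ := by
  obtain ⟨γ', hγ', h0, h1, hr, hfib⟩ := exists_continuous_monotone_fibres hγ
  obtain ⟨w, hw, hwm, hwe⟩ := exists_monotone_parameter hγ' hfib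
  have hlt : 0 < w 1 - w 0 := by
    refine sub_pos.2 (lt_of_le_of_ne (hwm unitInterval.nonneg') fun h => hne ?_)
    rw [← h0, ← h1, (hwe 0 1).1 h]
  let W : unitInterval → unitInterval := fun t => ⟨(w t - w 0) / (w 1 - w 0),
    div_nonneg (sub_nonneg.2 (hwm unitInterval.nonneg')) hlt.le,
    (div_le_one hlt).2 (sub_le_sub_right (hwm unitInterval.le_one') _)⟩
  have hW : Continuous W := by
    refine Continuous.subtype_mk ?_ _
    fun_prop
  have hW0 : W 0 = 0 := Subtype.ext (by simp [W])
  have hW1 : W 1 = 1 := Subtype.ext (by simp [W, hlt.ne'])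
  have hWs : Function.Surjective W := fun y => by
    have := intermediate_value_Icc (unitInterval.nonneg' : (0 : unitInterval) ≤ 1) hW.continuousOn
    rw [hW0, hW1] at this
    obtain ⟨t, -, ht⟩ := this ⟨unitInterval.nonneg', unitInterval.le_one'⟩
    exact ⟨t, ht⟩
  have hWe : ∀ s t, W s = W t ↔ γ' s = γ' t := fun s t => by
    rw [← hwe, Subtype.ext_iff]
    simp only [W]
    rw [div_left_inj' hlt.ne', sub_left_inj]
  have hq : IsQuotientMap W := hW.isClosedMap.isQuotientMap hW hWs
  obtain ⟨b, hb⟩ : ∃ b : C(unitInterval, Y), ∀ t, b (W t) = γ' t := by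
    have hq' : IsQuotientMap (⟨W, hW⟩ : C(unitInterval, unitInterval)) := hq
    have hf : Function.FactorsThrough (⟨γ', hγ'⟩ : C(unitInterval, Y)) (⟨W, hW⟩ : C(_, _)) :=
      fun s t h => (hWe s t).1 h
    exact ⟨hq'.lift _ hf, fun t => DFunLike.congr_fun (hq'.lift_comp _ hf) t⟩
  have hβ : ∀ t (ht : t ∈ Icc (0 : ℝ) 1), IccExtend zero_le_one b t = b ⟨t, ht⟩ := fun t ht =>
    IccExtend_of_mem _ _ ht
  refine ⟨IccExtend zero_le_one b, b.continuous.Icc_extend', ?_, ?_, ?_, ?_⟩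
  · rw [hβ 0 ⟨le_rfl, zero_le_one⟩, ← h0, ← hb, hW0]; rfl
  · rw [hβ 1 ⟨zero_le_one, le_rfl⟩, ← h1, ← hb, hW1]; rfl
  · intro s hs t ht hst
    rw [hβ s hs, hβ t ht] at hst
    obtain ⟨s', hs'⟩ := hWs ⟨s, hs⟩
    obtain ⟨t', ht'⟩ := hWs ⟨t, ht⟩
    rw [← hs', ← ht', hb, hb, ← hWe, hs', ht'] at hst
    exact congrArg Subtype.val hst
  · rintro _ ⟨t, ht, rfl⟩
    rw [hβ t ht]
    obtain ⟨t', ht'⟩ := hWs ⟨t, ht⟩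
    rw [← ht', hb]
    exact hr (mem_range_self _)

theorem JoinedIn.exists_arc {F : Set Y} {x y : Y} (h : JoinedIn F x y) (hne : x ≠ y) :
    ∃ β : ℝ → Y, Continuous β ∧ β 0 = x ∧ β 1 = y ∧ InjOn β (Icc 0 1) ∧ β '' Icc 0 1 ⊆ F := by
  obtain ⟨β, hβ, h0, h1, hi, hr⟩ := exists_arc_of_path h.somePath.continuous (by simpa using hne)
  refine ⟨β, hβ, by simpa using h0, by simpa using h1, hi, hr.trans ?_⟩
  rintro _ ⟨t, rfl⟩
  exact h.somePath_mem t

end Parametrization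

section NoCircle

variable {Y : Type*} [TopologicalSpace Y]

/-- The set `U` contains no simple closed curve. -/
def NoCircle (U : Set Y) : Prop :=
  ∀ c : Metric.sphere (0 : ℂ) 1 → Y, Continuous c → Function.Injective c → ¬ range c ⊆ U

theorem NoCircle.mono {U V : Set Y} (hV : NoCircle V) (h : U ⊆ V) : NoCircle U :=
  fun c hc hi hr => hV c hc hi (hr.trans h)

theorem NoCircle.loop_false {U : Set Y} (hU : NoCircle U) {γ : ℝ → Y} (hγ : Continuous γ) {a b : ℝ}
    (hab : a < b) (heq : γ a = γ b) (hi : InjOn γ (Ico a b)) (hr : ∀ t ∈ Icc a b, γ t ∈ U) :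
    False := by
  have hp : Fact (0 < b - a) := ⟨sub_pos.2 hab⟩
  have hc : Continuous (AddCircle.liftIco (b - a) a γ) :=
    AddCircle.liftIco_continuous (by simpa using heq) hγ.continuousOn
  have hsurj : ∀ x : AddCircle (b - a), ∃ t ∈ Ico a b, (t : AddCircle (b - a)) = x := fun x => by
    have : x ∈ ((↑) : ℝ → AddCircle (b - a)) '' Ico a (a + (b - a)) := by
      rw [AddCircle.coe_image_Ico_eq]; trivial
    simpa using this
  have hval : ∀ t ∈ Ico a b, AddCircle.liftIco (b - a) a γ (t : AddCircle (b - a)) = γ t :=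
    fun t ht => AddCircle.liftIco_coe_apply (by simpa using ht)
  let e : Metric.sphere (0 : ℂ) 1 → AddCircle (b - a) := fun z =>
    (AddCircle.homeomorphCircle hp.out.ne').symm ⟨z.1, z.2⟩
  have he : Continuous e := (Homeomorph.continuous _).comp
    (continuous_subtype_val.subtype_mk fun z => z.2)
  have hei : Function.Injective e := fun z w h =>
    Subtype.ext (congrArg Subtype.val ((AddCircle.homeomorphCircle hp.out.ne').symm.injective h))
  refine hU (AddCircle.liftIco (b - a) a γ ∘ e) (hc.comp he) (fun z w h => hei ?_) ?_
  · obtain ⟨s, hs, hse⟩ := hsurj (e z)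
    obtain ⟨t, ht, hte⟩ := hsurj (e w)
    simp only [Function.comp] at h
    rw [← hse, ← hte, hval s hs, hval t ht] at h
    rw [← hse, ← hte, hi hs ht h]
  · rintro _ ⟨z, rfl⟩
    obtain ⟨s, hs, hse⟩ := hsurj (e z)
    simp only [Function.comp]
    rw [← hse, hval s hs]
    exact hr s ⟨hs.1, hs.2.le⟩

/-- Two arcs with common endpoints and otherwise disjoint form a simple closed curve. -/
theorem NoCircle.two_arcs_false {U : Set Y} (hU : NoCircle U) {α β : ℝ → Y} (hα : Continuous α)
    (hβ : Continuous β) {a b c d : ℝ} (hab : a < b) (hcd : c < d) (hαi : InjOn α (Icc a b))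
    (hβi : InjOn β (Icc c d)) (hac : α a = β c) (hbd : α b = β d)
    (hdis : ∀ s ∈ Icc a b, ∀ t ∈ Ioo c d, α s ≠ β t) (hαU : ∀ s ∈ Icc a b, α s ∈ U)
    (hβU : ∀ t ∈ Icc c d, β t ∈ U) : False := by
  let γ : ℝ → Y := fun t => if t ≤ b then α t else β (d - (t - b))
  have hγ : Continuous γ := by
    refine Continuous.if_le hα (by fun_prop) continuous_id continuous_const fun t ht => ?_
    rw [ht, hbd]; simp
  refine hU.loop_false hγ (a := a) (b := b + (d - c)) (by linarith) ?_ ?_ ?_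
  · have h1 : ¬ b + (d - c) ≤ b := by linarith
    simp only [γ, if_pos hab.le, if_neg h1, hac]
    congr 1; ring
  · intro s hs t ht hst
    simp only [γ] at hst
    split_ifs at hst with h1 h2 h2
    · exact hαi ⟨hs.1, h1⟩ ⟨ht.1, h2⟩ hst
    · exact (hdis s ⟨hs.1, h1⟩ _ ⟨by linarith [ht.2], by linarith⟩ hst).elim
    · exact (hdis t ⟨ht.1, h2⟩ _ ⟨by linarith [hs.2], by linarith⟩ hst.symm).elim
    · have := hβi ⟨by linarith [hs.2], by linarith⟩ ⟨by linarith [ht.2], by linarith⟩ hst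
      linarith
  · intro t ht
    simp only [γ]
    split_ifs with h
    · exact hαU t ⟨ht.1, h⟩
    · exact hβU _ ⟨by linarith [ht.2], by linarith⟩

end NoCircle

section Separation

variable {Y : Type*} [MetricSpace Y]

/-- An interior point of an arc in a set without simple closed curves separates the endpoints of the
arc in this set. -/
theorem NoCircle.not_joinedIn {U : Set Y} (hU : NoCircle U) {α : ℝ → Y} (hα : Continuous α)
    {a b s₀ : ℝ} (has : a < s₀) (hsb : s₀ < b) (hi : InjOn α (Icc a b))
    (hαU : ∀ s ∈ Icc a b, α s ∈ U) : ¬ JoinedIn (U \ {α s₀}) (α a) (α b) := by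
  intro hj
  have hab := has.trans hsb
  have hne : α a ≠ α b := fun h => hab.ne (hi ⟨le_rfl, hab.le⟩ ⟨hab.le, le_rfl⟩ h)
  obtain ⟨β, hβ, h0, h1, hβi, hβU⟩ := hj.exists_arc hne
  have hβU' : ∀ t ∈ Icc (0 : ℝ) 1, β t ∈ U ∧ β t ≠ α s₀ := fun t ht => hβU (mem_image_of_mem β ht)
  have hcl : ∀ c d, IsClosed (β ⁻¹' (α '' Icc c d)) := fun c d =>
    (isCompact_Icc.image hα).isClosed.preimage hβ
  obtain ⟨t₁, ht₁⟩ := (isCompact_Icc.inter_right (hcl a s₀)).exists_isGreatest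
    (show (Icc (0 : ℝ) 1 ∩ β ⁻¹' (α '' Icc a s₀)).Nonempty from
      ⟨0, ⟨le_rfl, zero_le_one⟩, a, ⟨le_rfl, has.le⟩, h0.symm⟩)
  obtain ⟨t₂, ht₂⟩ := (isCompact_Icc.inter_right (hcl s₀ b)).exists_isLeast
    (show (Icc t₁ 1 ∩ β ⁻¹' (α '' Icc s₀ b)).Nonempty from
      ⟨1, ⟨ht₁.1.1.2, le_rfl⟩, b, ⟨hsb.le, le_rfl⟩, h1.symm⟩)
  obtain ⟨s₁, hs₁, hs₁e⟩ := ht₁.1.2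
  obtain ⟨s₂, hs₂, hs₂e⟩ := ht₂.1.2
  have hs₁l : s₁ < s₀ := lt_of_le_of_ne hs₁.2 (by
    rintro rfl; exact (hβU' t₁ ht₁.1.1).2 hs₁e.symm)
  have hs₂l : s₀ < s₂ := lt_of_le_of_ne hs₂.1 (by
    rintro rfl; exact (hβU' t₂ ⟨ht₁.1.1.1.trans ht₂.1.1.1, ht₂.1.1.2⟩).2 hs₂e.symm)
  have h₁₂ : t₁ < t₂ := lt_of_le_of_ne ht₂.1.1.1 (by
    rintro rfl
    exact (hs₁l.trans hs₂l).ne (hi ⟨hs₁.1, by linarith⟩ ⟨by linarith, hs₂.2⟩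
      (hs₁e.trans hs₂e.symm)))
  have hs : Icc s₁ s₂ ⊆ Icc a b := Icc_subset_Icc hs₁.1 hs₂.2
  have ht : Icc t₁ t₂ ⊆ Icc 0 1 := Icc_subset_Icc ht₁.1.1.1 ht₂.1.1.2
  refine hU.two_arcs_false hα hβ (hs₁l.trans hs₂l) h₁₂ (hi.mono hs) (hβi.mono ht) hs₁e hs₂e ?_
    (fun s h => hαU s (hs h)) (fun t h => (hβU' t (ht h)).1)
  intro s h t h' hst
  have htt := ht ⟨h'.1.le, h'.2.le⟩
  rcases le_total s s₀ with hl | hl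
  · exact h'.1.not_ge (ht₁.2 ⟨htt, s, ⟨hs₁.1.trans h.1, hl⟩, hst⟩)
  · exact h'.2.not_ge (ht₂.2 ⟨⟨h'.1.le, htt.2⟩, s, ⟨hl, h.2.trans hs₂.2⟩, hst⟩)

/-- A subset of a set without simple closed curves contains every arc between points which
it joins. -/
theorem NoCircle.mem_of_joinedIn {U G : Set Y} (hU : NoCircle U) (hG : G ⊆ U) {α : ℝ → Y}
    (hα : Continuous α) {a b : ℝ} (hi : InjOn α (Icc a b))
    (hαU : ∀ s ∈ Icc a b, α s ∈ U) (hj : JoinedIn G (α a) (α b)) {s : ℝ} (hs : s ∈ Icc a b) :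
    α s ∈ G := by
  rcases hs.1.eq_or_lt with rfl | h1
  · exact hj.source_mem
  rcases hs.2.eq_or_lt with rfl | h2
  · exact hj.target_mem
  by_contra hsG
  refine hU.not_joinedIn hα h1 h2 hi hαU (hj.mono fun x hx => ⟨hG hx, ?_⟩)
  rintro rfl
  exact hsG hx

end Separation

section LocalDendrite

theorem IsDendriteSet.noCircle {Y : Type*} [TopologicalSpace Y] [T2Space Y] {D : Set Y}
    (hD : IsDendriteSet D) : NoCircle D := by
  intro c hc hi hr
  have hr' : ∀ z, c z ∈ D := fun z => hr (mem_range_self z)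
  let c' : Metric.sphere (0 : ℂ) 1 → D := fun z => ⟨c z, hr' z⟩
  have : CompactSpace (Metric.sphere (0 : ℂ) 1) := isCompact_iff_compactSpace.1 (isCompact_sphere _ _)
  have hc' : Continuous c' := hc.subtype_mk _
  have hi' : Function.Injective c' := fun z w h => hi (congrArg Subtype.val h)
  exact hD.2.2.2 ⟨range c', ⟨(hc'.isClosedEmbedding hi').isEmbedding.toHomeomorph.symm⟩⟩

theorem IsLocalDendrite.locallyConnectedSpace {Y : Type*} [TopologicalSpace Y]
    (hY : IsLocalDendrite Y) : LocallyConnectedSpace Y := by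
  rw [locallyConnectedSpace_iff_connected_subsets]
  intro x U hU
  obtain ⟨D, hD, hD'⟩ := hY x
  have := hD'.2.2.1
  have hm := map_nhds_subtype_coe_eq_nhds (p := (· ∈ D)) (mem_of_mem_nhds hD) hD
  obtain ⟨V, hV, hVc, hVU⟩ := locallyConnectedSpace_iff_connected_subsets.1 this
    ⟨x, mem_of_mem_nhds hD⟩ (Subtype.val ⁻¹' U) (by
      rw [← hm] at hU; exact hU)
  refine ⟨Subtype.val '' V, ?_, hVc.image _ continuous_subtype_val.continuousOn,
    image_subset_iff.2 hVU⟩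
  rw [← hm]
  exact image_mem_map hV

theorem IsLocalDendrite.exists_noCircle_ball {Y : Type*} [MetricSpace Y] [CompactSpace Y]
    (hY : IsLocalDendrite Y) : ∃ ρ > 0, ∀ x : Y, NoCircle (Metric.ball x ρ) := by
  choose D hD hD' using hY
  obtain ⟨ρ, hρ, h⟩ := lebesgue_number_lemma_of_metric (c := fun x => interior (D x))
    (isCompact_univ : IsCompact (univ : Set Y)) (fun _ => isOpen_interior)
    fun x _ => mem_iUnion.2 ⟨x, mem_interior_iff_mem_nhds.2 (hD x)⟩
  refine ⟨ρ, hρ, fun x => ?_⟩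
  obtain ⟨i, hi⟩ := h x (mem_univ _)
  exact (hD' i).noCircle.mono (hi.trans interior_subset)

end LocalDendrite

section Entropy

theorem polGrowth_eq_zero_of_le {u : ℕ → ℕ∞} (M : ℕ) (hM : ∀ n, u n ≤ M) : polGrowth u = 0 := by
  have hlim : Tendsto (fun n : ℕ => ENNReal.ofReal (Real.log M / Real.log n)) atTop (𝓝 0) := by
    have h1 : Tendsto (fun n : ℕ => Real.log M / Real.log n) atTop (𝓝 0) :=
      (Real.tendsto_log_atTop.comp tendsto_natCast_atTop_atTop).const_div_atTop _
    simpa using ENNReal.tendsto_ofReal h1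
  refine le_antisymm ?_ bot_le
  rw [← hlim.limsup_eq]
  refine limsup_le_limsup (Eventually.of_forall fun n => ?_)
  have hne : u n ≠ ⊤ := ne_top_of_le_ne_top (ENat.natCast_ne_top M) (hM n)
  simp only [if_neg hne]
  have hle : (u n).toNat ≤ M := ENat.toNat_le_of_le_natCast (hM n)
  refine ENNReal.ofReal_le_ofReal (div_le_div_of_nonneg_right ?_ (Real.log_natCast_nonneg n))
  rcases Nat.eq_zero_or_pos (u n).toNat with h | h
  · rw [h]
    simpa using Real.log_natCast_nonneg M
  · exact Real.log_le_log (by exact_mod_cast h) (by exact_mod_cast hle)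

theorem hpol_eq_zero_of_equicontinuous {Y : Type*} [PseudoMetricSpace Y] [CompactSpace Y]
    {g : Y → Y}
    (hg : ∀ ε > 0, ∃ δ > 0, ∀ n x y, dist x y < δ → dist (g^[n] x) (g^[n] y) < ε) :
    hpol g = 0 := by
  simp only [hpol, ENNReal.iSup_eq_zero]
  intro ε hε
  obtain ⟨δ, hδ, h⟩ := hg ε hε
  obtain ⟨t, -, htf, ht⟩ := finite_cover_balls_of_compact (isCompact_univ : IsCompact (univ : Set Y))
    (half_pos hδ)
  have hex : ∀ x : Y, ∃ c ∈ t, dist x c < δ / 2 := fun x => by simpa using ht (mem_univ x)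
  choose c hc hxc using hex
  refine polGrowth_eq_zero_of_le htf.toFinset.card fun n => iSup₂_le fun E hE => ?_
  refine Nat.cast_le.2 (Finset.card_le_card_of_injOn c (fun x _ => by simpa using hc x) ?_)
  intro x hx y hy hxy
  by_contra hne
  refine (hE x hx y hy hne).not_gt ?_
  have hd : dist x y < δ := by
    have h1 := hxc x
    have h2 := hxc y
    rw [← hxy] at h2
    linarith [dist_triangle_right x y (c x)]
  rw [dynDist, ← Real.coe_toNNReal ε hε.le, NNReal.coe_lt_coe, Finset.sup_lt_iff]
  · intro k _
    rw [← NNReal.coe_lt_coe, coe_nndist, Real.coe_toNNReal ε hε.le]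
    exact h k x y hd
  · simpa using hε

theorem coe_iterate_hyperMap {Y : Type*} [TopologicalSpace Y] {f : Y → Y} (hf : Continuous f)
    (n : ℕ) (A : NonemptyCompacts Y) :
    (((hyperMap f hf)^[n] A : NonemptyCompacts Y) : Set Y) = f^[n] '' A := by
  induction n with
  | zero => simp
  | succ n ih =>
    rw [Function.iterate_succ_apply', Function.iterate_succ', image_comp, ← ih]
    rfl

theorem hpol_hyperMap_eq_zero_of_equicontinuous {Y : Type*} [MetricSpace Y] [CompactSpace Y]
    {f : Y → Y} (hf : Continuous f)
    (h : ∀ ε > 0, ∃ δ > 0, ∀ n x y, dist x y < δ → dist (f^[n] x) (f^[n] y) < ε) :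
    hpol (hyperMap f hf) = 0 := by
  refine hpol_eq_zero_of_equicontinuous fun ε hε => ?_
  obtain ⟨δ, hδ, h⟩ := h (ε / 2) (half_pos hε)
  refine ⟨δ, hδ, fun n A B hAB => lt_of_le_of_lt ?_ (half_lt_self hε)⟩
  rw [Metric.NonemptyCompacts.dist_eq] at hAB ⊢
  have hfin := Metric.hausdorffEDist_ne_top_of_nonempty_of_bounded A.nonempty B.nonempty
    A.isCompact.isBounded B.isCompact.isBounded
  rw [coe_iterate_hyperMap, coe_iterate_hyperMap]
  refine Metric.hausdorffDist_le_of_mem_dist (half_pos hε).le ?_ ?_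
  · rintro _ ⟨x, hx, rfl⟩
    obtain ⟨y, hy, hxy⟩ := Metric.exists_dist_lt_of_hausdorffDist_lt hx hAB hfin
    exact ⟨_, mem_image_of_mem _ hy, (h n x y hxy).le⟩
  · rintro _ ⟨x, hx, rfl⟩
    obtain ⟨y, hy, hxy⟩ := Metric.exists_dist_lt_of_hausdorffDist_lt' hx hAB hfin
    exact ⟨_, mem_image_of_mem _ hy, (h n x y (by rwa [dist_comm])).le⟩

end Entropy

section NonWandering

variable {Y : Type*} [TopologicalSpace Y]

theorem Homeomorph.pow_add_apply (f : Y ≃ₜ Y) (m n : ℕ) (x : Y) :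
    (f ^ (m + n)) x = (f ^ m) ((f ^ n) x) := by
  rw [pow_add]; rfl

theorem Homeomorph.pow_mul_apply (f : Y ≃ₜ Y) (m n : ℕ) (x : Y) :
    (f ^ (m * n)) x = ((f ^ m) ^ n) x := by
  rw [pow_mul]

theorem Homeomorph.coe_pow_eq_iterate (f : Y ≃ₜ Y) (n : ℕ) : ⇑(f ^ n) = f^[n] := by
  induction n with
  | zero => rfl
  | succ n ih =>
    ext x
    rw [Function.iterate_succ_apply', ← ih, add_comm, f.pow_add_apply, pow_one]

theorem Homeomorph.inv_apply_self (f : Y ≃ₜ Y) (x : Y) : f⁻¹ (f x) = x := f.symm_apply_apply x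

theorem Homeomorph.apply_inv_self (f : Y ≃ₜ Y) (x : Y) : f (f⁻¹ x) = x := f.apply_symm_apply x

theorem Homeomorph.pow_inv_pow_apply (f : Y ≃ₜ Y) (n : ℕ) (x : Y) :
    (f ^ n) ((f⁻¹ ^ n) x) = x := by
  rw [inv_pow, apply_inv_self]

theorem Homeomorph.inv_pow_pow_apply (f : Y ≃ₜ Y) (n : ℕ) (x : Y) :
    (f⁻¹ ^ n) ((f ^ n) x) = x := by
  rw [inv_pow, inv_apply_self]

/-- Every nonempty open set meets one of its forward images. -/
def IsNonwandering (f : Y ≃ₜ Y) : Prop :=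
  ∀ O : Set Y, IsOpen O → O.Nonempty → ∃ k, 1 ≤ k ∧ ∃ x ∈ O, (f ^ k) x ∈ O

theorem isNonwandering_homeomorph {f : Y → Y} (hf : IsHomeomorph f)
    (hw : ∀ p, ¬ IsWanderingPoint f p) : IsNonwandering (hf.homeomorph f) := by
  rintro O hO ⟨p, hp⟩
  by_contra! hcon
  refine hw p ⟨O, hO, hp, fun n hn => ?_⟩
  rw [eq_empty_iff_forall_notMem]
  rintro _ ⟨⟨x, hx, rfl⟩, hx'⟩
  refine hcon n hn x hx ?_
  rwa [Homeomorph.coe_pow_eq_iterate]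

theorem IsNonwandering.inv {f : Y ≃ₜ Y} (hf : IsNonwandering f) : IsNonwandering f⁻¹ := by
  intro O hO hne
  obtain ⟨k, hk, x, hx, hx'⟩ := hf O hO hne
  exact ⟨k, hk, _, hx', by rwa [f.inv_pow_pow_apply]⟩

theorem IsNonwandering.exists_returns {f : Y ≃ₜ Y} (hf : IsNonwandering f) (j : ℕ) :
    ∀ O : Set Y, IsOpen O → O.Nonempty →
      ∃ x, ∃ S : Finset ℕ, S.card = j + 1 ∧ ∀ n ∈ S, (f ^ n) x ∈ O := by
  induction j with
  | zero =>
    rintro O - ⟨x, hx⟩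
    exact ⟨x, {0}, rfl, by simpa using hx⟩
  | succ j ih =>
    intro O hO hne
    obtain ⟨k, hk, x, hx, hx'⟩ := hf O hO hne
    obtain ⟨y, S, hS, hyS⟩ := ih (O ∩ (f ^ k) ⁻¹' O) (hO.inter (hO.preimage (f ^ k).continuous))
      ⟨x, hx, hx'⟩
    have hSne : S.Nonempty := Finset.card_pos.1 (by omega)
    have hmax := S.max'_mem hSne
    refine ⟨y, insert (k + S.max' hSne) S, ?_, ?_⟩
    · rw [Finset.card_insert_of_notMem, hS]
      intro h
      have := S.le_max' _ h
      omega
    · intro n hn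
      rcases Finset.mem_insert.1 hn with rfl | hn
      · rw [f.pow_add_apply]
        exact (hyS _ hmax).2
      · exact (hyS n hn).1

theorem IsNonwandering.pow {f : Y ≃ₜ Y} (hf : IsNonwandering f) {m : ℕ} (hm : 1 ≤ m) :
    IsNonwandering (f ^ m) := by
  intro O hO hne
  obtain ⟨x, S, hS, hx⟩ := hf.exists_returns m O hO hne
  obtain ⟨i, hi, j, hj, hij, hmod⟩ := Finset.exists_ne_map_eq_of_card_lt_of_maps_to
    (t := Finset.range m) (f := fun n => n % m) (s := S) (by simp [hS])
    (fun n _ => by simpa using Nat.mod_lt n hm)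
  have key : ∀ i j, i ∈ S → j ∈ S → i < j → i % m = j % m →
      ∃ k, 1 ≤ k ∧ ∃ x ∈ O, ((f ^ m) ^ k) x ∈ O := by
    intro i j hi hj hij hmod
    obtain ⟨k, hk⟩ : m ∣ j - i := (Nat.modEq_iff_dvd' hij.le).1 hmod
    refine ⟨k, Nat.pos_of_ne_zero ?_, (f ^ i) x, hx i hi, ?_⟩
    · rintro rfl
      omega
    · rw [← f.pow_mul_apply, ← hk, ← f.pow_add_apply, Nat.sub_add_cancel hij.le]
      exact hx j hj
  rcases lt_or_gt_of_ne hij with h | h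
  · exact key i j hi hj h hmod
  · exact key j i hj hi h hmod.symm

theorem IsNonwandering.eq_empty_or_univ [PreconnectedSpace Y] {g : Y ≃ₜ Y} (hg : IsNonwandering g)
    {A : Set Y} (hA : IsOpen A) (h : ∀ x ∈ closure A, g x ∈ A) : A = ∅ ∨ A = univ := by
  have hcl : IsClosed (g '' closure A) := g.isClosedMap _ isClosed_closure
  have hiter : ∀ k, ∀ x ∈ A, (g ^ k) x ∈ A := by
    intro k
    induction k with
    | zero => exact fun x hx => hx
    | succ k ih =>
      intro x hx
      rw [g.pow_add_apply, pow_one]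
      exact ih _ (h x (subset_closure hx))
  have hO : A ⊆ g '' closure A := by
    by_contra hcon
    obtain ⟨p, hp⟩ : (A \ g '' closure A).Nonempty := by
      rwa [nonempty_iff_ne_empty, Ne, sdiff_eq_empty]
    obtain ⟨k, hk, x, hx, hx'⟩ := hg _ (hA.sdiff hcl) ⟨p, hp⟩
    refine hx'.2 ⟨(g ^ (k - 1)) x, subset_closure (hiter _ x hx.1), ?_⟩
    conv_rhs => rw [← Nat.add_sub_cancel' hk, g.pow_add_apply, pow_one]
  have heq : A = g '' closure A := hO.antisymm (image_subset_iff.2 h)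
  exact isClopen_iff.1 ⟨heq ▸ hcl, hA⟩

/-- If `B` is a branch at a non-periodic point, then some power of a nonwandering homeomorphism
maps the complement of `B` into `B`. -/
theorem IsNonwandering.exists_mapsTo_of_branch [PreconnectedSpace Y] [T1Space Y] {f : Y ≃ₜ Y}
    (hf : IsNonwandering f) {B : Set Y} {r : Y} (hB : IsOpen B) (hBc : IsConnected B)
    (hBr : closure B ⊆ insert r B) (hr : r ∉ B) (hper : ∀ m, 1 ≤ m → (f ^ m) r ≠ r) :
    ∃ m, 1 ≤ m ∧ ∀ x ∉ B, (f ^ m) x ∈ B := by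
  obtain ⟨m, hm, x, hx, hx'⟩ := hf B hB hBc.nonempty
  refine ⟨m, hm, ?_⟩
  have hper' := hper m hm
  have hg := hf.pow hm
  set g := f ^ m
  have hgB : IsOpen (g '' B) := g.isOpenMap _ hB
  have hgc : IsPreconnected (g '' B) := hBc.isPreconnected.image g g.continuous.continuousOn
  have hgcl : closure (g '' B) ⊆ insert (g r) (g '' B) := by
    rw [← g.image_closure, ← image_insert_eq]
    exact image_mono hBr
  have hmeet : (B ∩ g '' B).Nonempty := ⟨g x, hx', mem_image_of_mem g hx⟩
  have hnu : B ≠ univ := fun h => hr (h ▸ mem_univ r)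
  have hrcl : r ∈ closure B := by
    by_contra hcon
    have hcl : IsClosed B := isClosed_of_closure_subset fun y hy => by
      rcases hBr hy with rfl | h
      exacts [(hcon hy).elim, h]
    rcases isClopen_iff.1 ⟨hcl, hB⟩ with h | h
    exacts [hBc.nonempty.ne_empty h, hnu h]
  have h1 : r ∉ g '' B → g '' B ⊆ B := fun h =>
    hgc.subset_of_closure_inter_subset hB (by rwa [inter_comm]) fun y hy => by
      rcases hBr hy.1 with rfl | h'
      exacts [(h hy.2).elim, h']
  have h2 : g r ∉ B → B ⊆ g '' B := fun h =>
    hBc.isPreconnected.subset_of_closure_inter_subset hgB hmeet fun y hy => by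
      rcases hgcl hy.1 with rfl | h'
      exacts [(h hy.2).elim, h']
  by_cases hr1 : g r ∈ B <;> by_cases hr2 : r ∈ g '' B
  · have hU : B ∪ g '' B = univ := by
      have hcl : IsClosed (B ∪ g '' B) := isClosed_of_closure_subset fun y hy => by
        rw [closure_union] at hy
        rcases hy with hy | hy
        · rcases hBr hy with rfl | h'
          exacts [Or.inr hr2, Or.inl h']
        · rcases hgcl hy with rfl | h'
          exacts [Or.inl hr1, Or.inr h']
      exact (isClopen_iff.1 ⟨hcl, hB.union hgB⟩).resolve_left
        (hBc.nonempty.mono subset_union_left).ne_empty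
    intro y hy
    rcases (hU.symm ▸ mem_univ (g y) : g y ∈ B ∪ g '' B) with h | h
    · exact h
    · exact (hy (g.injective.mem_set_image.1 h)).elim
  · rcases hg.eq_empty_or_univ hB (fun y hy => by
      rcases hBr hy with rfl | h'
      exacts [hr1, h1 hr2 (mem_image_of_mem g h')]) with h | h
    exacts [(hBc.nonempty.ne_empty h).elim, (hnu h).elim]
  · rcases hg.inv.eq_empty_or_univ hB (fun y hy => by
      rcases hBr hy with rfl | h'
      · obtain ⟨z, hz, hz'⟩ := hr2
        rw [← hz', g.inv_apply_self]
        exact hz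
      · obtain ⟨z, hz, hz'⟩ := h2 hr1 h'
        rw [← hz', g.inv_apply_self]
        exact hz) with h | h
    exacts [(hBc.nonempty.ne_empty h).elim, (hnu h).elim]
  · have heq : g '' B = B := (h1 hr2).antisymm (h2 hr1)
    have : g r ∈ closure B := by
      rw [← heq, ← g.image_closure]
      exact mem_image_of_mem g hrcl
    rcases hBr this with h | h
    exacts [(hper' h).elim, (hr1 h).elim]

/-- Two disjoint branches cannot both be attached at non-periodic points. -/
theorem IsNonwandering.false_of_disjoint_branches [PreconnectedSpace Y] [T1Space Y] {f : Y ≃ₜ Y}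
    (hf : IsNonwandering f) {B B' : Set Y} {r r' : Y} (hB : IsOpen B) (hBc : IsConnected B)
    (hBr : closure B ⊆ insert r B) (hr : r ∉ B) (hper : ∀ m, 1 ≤ m → (f ^ m) r ≠ r)
    (hB' : IsOpen B') (hBc' : IsConnected B')
    (hBr' : closure B' ⊆ insert r' B') (hr' : r' ∉ B') (hper' : ∀ m, 1 ≤ m → (f ^ m) r' ≠ r')
    (hd : Disjoint B B') : False := by
  obtain ⟨m, hm, h⟩ := hf.exists_mapsTo_of_branch hB hBc hBr hr hper
  obtain ⟨m', hm', h'⟩ := hf.exists_mapsTo_of_branch hB' hBc' hBr' hr' hper'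
  rcases (hf.pow (le_add_right hm' : 1 ≤ m' + m)).eq_empty_or_univ hB' (fun y hy => by
    rw [f.pow_add_apply]
    exact h' _ (disjoint_left.1 hd (h y (disjoint_right.1 (hd.closure_right hB) hy)))) with h | h
  exacts [hBc'.nonempty.ne_empty h, hr' (h ▸ mem_univ r')]

end NonWandering

section LimitArc

theorem joinedIn_of_mapsTo_Icc {Y : Type*} [TopologicalSpace Y] {F : Set Y} {γ : ℝ → Y}
    (hγ : Continuous γ) {a b : ℝ} (h : MapsTo γ (Icc a b) F) {s t : ℝ} (hs : s ∈ Icc a b)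
    (ht : t ∈ Icc a b) : JoinedIn F (γ s) (γ t) :=
  ((((convex_Icc a b).isPathConnected ⟨s, hs⟩).image hγ).joinedIn _ (mem_image_of_mem γ hs) _
    (mem_image_of_mem γ ht)).mono (image_subset_iff.2 h)

variable {Y : Type*} [MetricSpace Y]

theorem JoinedIn.exists_dist_eq {F : Set Y} {x y : Y} (h : JoinedIn F x y) {r : ℝ} (hr : 0 ≤ r)
    (hxy : r ≤ dist y x) :
    ∃ z, dist z x = r ∧ JoinedIn (F ∩ Metric.closedBall x r) x z := by
  let γ : ℝ → Y := h.somePath.extend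
  have hγ : Continuous γ := h.somePath.continuous_extend
  have h0 : γ 0 = x := h.somePath.extend_zero
  have h1 : γ 1 = y := h.somePath.extend_one
  have hd : Continuous fun t => dist (γ t) x := hγ.dist continuous_const
  have hF : ∀ t ∈ Icc (0 : ℝ) 1, γ t ∈ F := fun t ht => by
    simp only [γ, Path.extend_apply _ ht]
    exact h.somePath_mem _
  have ivt : ∀ t ∈ Icc (0 : ℝ) 1, r ≤ dist (γ t) x → ∃ s ∈ Icc 0 t, dist (γ s) x = r :=
    fun t ht hrt => intermediate_value_Icc ht.1 hd.continuousOn ⟨by simpa [h0] using hr, hrt⟩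
  obtain ⟨s, hs, hsr⟩ := ivt 1 ⟨zero_le_one, le_rfl⟩ (by rwa [h1])
  obtain ⟨t₀, ht₀⟩ := (isCompact_Icc.inter_right
    (isClosed_singleton.preimage hd : IsClosed ((fun t => dist (γ t) x) ⁻¹' {r}))).exists_isLeast
    (show (Icc (0 : ℝ) 1 ∩ (fun t => dist (γ t) x) ⁻¹' {r}).Nonempty from ⟨s, hs, hsr⟩)
  have ht₀1 := ht₀.1.1.2
  have hj : JoinedIn (F ∩ Metric.closedBall x r) (γ 0) (γ t₀) := by
    suffices hmaps : MapsTo γ (Icc 0 t₀) (F ∩ Metric.closedBall x r) from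
      joinedIn_of_mapsTo_Icc hγ hmaps ⟨le_rfl, ht₀.1.1.1⟩ ⟨ht₀.1.1.1, le_rfl⟩
    refine fun t ht => ⟨hF t ⟨ht.1, ht.2.trans ht₀1⟩, ?_⟩
    rw [Metric.mem_closedBall]
    by_contra! hcon
    obtain ⟨s, hs, hsr⟩ := ivt t ⟨ht.1, ht.2.trans ht₀1⟩ hcon.le
    have h2 : t₀ ≤ s := ht₀.2 ⟨⟨hs.1, hs.2.trans (ht.2.trans ht₀1)⟩, hsr⟩
    have h3 : s = t := by linarith [hs.2, ht.2]
    rw [h3] at hsr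
    exact hcon.ne' hsr
  rw [h0] at hj
  exact ⟨γ t₀, ht₀.1.2, hj⟩

/-- Infinitely many sets of a sequence of path connected sets with diameters bounded from
below contain a common arc. -/
theorem exists_arc_of_forall_dist_ge [CompactSpace Y] [LocallyPathConnectedSpace Y] {ρ : ℝ}
    (hρ : 0 < ρ) (hnc : ∀ x : Y, NoCircle (Metric.ball x ρ)) {ε : ℝ} (hε : 0 < ε) {G : ℕ → Set Y}
    {x y : ℕ → Y} (hG : ∀ j, JoinedIn (G j) (x j) (y j)) (hxy : ∀ j, ε ≤ dist (y j) (x j)) :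
    ∃ z, ∃ α : ℝ → Y, Continuous α ∧ InjOn α (Icc 0 1) ∧ MapsTo α (Icc 0 1) (Metric.ball z ρ) ∧
      ∃ φ : ℕ → ℕ, StrictMono φ ∧ ∀ j, MapsTo α (Icc 0 1) (G (φ j)) := by
  set r := min ρ ε / 2 with hr
  have hr0 : 0 < r := half_pos (lt_min hρ hε)
  have hrρ : r < ρ := by have := min_le_left ρ ε; linarith
  have hrε : r ≤ ε := by have := min_le_right ρ ε; linarith
  choose b hb hj using fun j => (hG j).exists_dist_eq hr0.le (hrε.trans (hxy j))
  obtain ⟨⟨a', b'⟩, -, φ, hφ, hlim⟩ := (isCompact_univ : IsCompact (univ : Set (Y × Y))).tendsto_subseq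
    (x := fun j => (x j, b j)) fun _ => mem_univ _
  have hxl : Tendsto (fun j => x (φ j)) atTop (𝓝 a') := (continuous_fst.tendsto _).comp hlim
  have hbl : Tendsto (fun j => b (φ j)) atTop (𝓝 b') := (continuous_snd.tendsto _).comp hlim
  have hab : dist b' a' = r := tendsto_nhds_unique (hbl.dist hxl) (by simp [hb])
  set U := Metric.ball a' ρ with hU
  have hUo : IsOpen U := Metric.isOpen_ball
  have ha'U : a' ∈ U := Metric.mem_ball_self hρ
  have hb'U : b' ∈ U := by rw [hU, Metric.mem_ball, hab]; exact hrρ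
  have hsub : ∀ᶠ j in atTop, G (φ j) ∩ Metric.closedBall (x (φ j)) r ⊆ U := by
    filter_upwards [hxl.eventually (Metric.ball_mem_nhds a' (sub_pos.2 hrρ))] with j hj z hz
    have h1 := hz.2
    rw [Metric.mem_closedBall] at h1
    rw [hU, Metric.mem_ball]
    linarith [dist_triangle z (x (φ j)) a']
  have hcomp : ∀ V : Set Y, IsOpen V → ∀ c ∈ V, ∀ u : ℕ → Y, Tendsto u atTop (𝓝 c) →
      ∀ᶠ j in atTop, JoinedIn V c (u j) := fun V hV c hc u hu =>
    hu.eventually ((hV.pathComponentIn c).mem_nhds (mem_pathComponentIn_self hc))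
  have hjU : JoinedIn U a' b' := by
    obtain ⟨j, h1, h2, h3⟩ := ((hcomp U hUo a' ha'U _ hxl).and
      ((hcomp U hUo b' hb'U _ hbl).and hsub)).exists
    exact (h1.trans ((hj (φ j)).mono h3)).trans h2.symm
  obtain ⟨α, hα, hα0, hα1, hαi, hαU⟩ := hjU.exists_arc (by
    rintro rfl; rw [dist_self] at hab; exact hr0.ne hab)
  have hαU' : ∀ s ∈ Icc (0 : ℝ) 1, α s ∈ U := fun s hs => hαU (mem_image_of_mem α hs)
  let F : ℕ → Set Y := fun j => pathComponentIn (G j ∩ Metric.closedBall (x j) r) (x j)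
  have hFp : ∀ j, IsPathConnected (F j) := fun j => isPathConnected_pathComponentIn (hj j).source_mem
  have hFj : ∀ j, JoinedIn (F j) (x j) (b j) := fun j => (hFp j).joinedIn _
    (mem_pathComponentIn_self (hj j).source_mem) _ (hj j)
  have hFU : ∀ᶠ j in atTop, F (φ j) ⊆ U := hsub.mono fun j h => pathComponentIn_subset.trans h
  have hmem : ∀ s ∈ Ioo (0 : ℝ) 1, ∀ᶠ j in atTop, α s ∈ F (φ j) := by
    intro s hs
    have hVo : IsOpen (U \ {α s}) := hUo.sdiff isClosed_singleton
    have h0 : a' ∈ U \ {α s} := ⟨ha'U, fun h => hs.1.ne (hαi ⟨le_rfl, zero_le_one⟩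
      ⟨hs.1.le, hs.2.le⟩ (hα0.trans h))⟩
    have h1 : b' ∈ U \ {α s} := ⟨hb'U, fun h => hs.2.ne' (hαi ⟨zero_le_one, le_rfl⟩
      ⟨hs.1.le, hs.2.le⟩ (hα1.trans h))⟩
    filter_upwards [hcomp _ hVo a' h0 _ hxl, hcomp _ hVo b' h1 _ hbl, hFU] with j h2 h3 h4
    by_contra hcon
    refine (hnc a').not_joinedIn hα hs.1 hs.2 hαi hαU' ?_
    rw [hα0, hα1]
    exact (h2.trans ((hFj (φ j)).mono fun z hz => ⟨h4 hz, by rintro rfl; exact hcon hz⟩)).trans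
      h3.symm
  have hinner : ∀ t ∈ Icc (0 : ℝ) 1, 1 / 3 + t / 3 ∈ Icc (1 / 3 : ℝ) (2 / 3) := fun t ht =>
    ⟨by linarith [ht.1], by linarith [ht.2]⟩
  have hsub' : Icc (1 / 3 : ℝ) (2 / 3) ⊆ Icc 0 1 := Icc_subset_Icc (by norm_num) (by norm_num)
  obtain ⟨N, hN⟩ := eventually_atTop.1 ((hmem (1 / 3) (by norm_num)).and
    ((hmem (2 / 3) (by norm_num)).and hFU))
  refine ⟨a', fun t => α (1 / 3 + t / 3), by fun_prop, ?_,
    fun t ht => hαU' _ (hsub' (hinner t ht)), fun j => φ (j + N),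
    hφ.comp (strictMono_id.add_const N), fun j t ht => ?_⟩
  · intro s hs t ht hst
    have := hαi (hsub' (hinner s hs)) (hsub' (hinner t ht)) hst
    linarith
  · obtain ⟨h1, h2, h3⟩ := hN (j + N) (Nat.le_add_left _ _)
    refine (pathComponentIn_subset ((hnc a').mem_of_joinedIn h3 hα (hαi.mono hsub')
      (fun s hs => hαU' s (hsub' hs)) ((hFp _).joinedIn _ h1 _ h2) (hinner t ht))).1

end LimitArc

section Branches

variable {Y : Type*} [MetricSpace Y]

/-- In a set without simple closed curves, the common endpoint of two arcs which are otherwise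
disjoint separates the other endpoints. -/
theorem NoCircle.not_joinedIn_of_inter_subset {U F F' : Set Y} (hU : NoCircle U) (hF : F ⊆ U)
    (hF' : F' ⊆ U) {x r y : Y} (hx : JoinedIn F x r) (hy : JoinedIn F' r y) (hxr : x ≠ r)
    (hry : r ≠ y) (hFF : F ∩ F' ⊆ {r}) : ¬ JoinedIn (U \ {r}) x y := by
  obtain ⟨β, hβ, hβ0, hβ1, hβi, hβF⟩ := hx.exists_arc hxr
  obtain ⟨δ, hδ, hδ0, hδ1, hδi, hδF⟩ := hy.exists_arc hry
  have hβF' : ∀ t ∈ Icc (0 : ℝ) 1, β t ∈ F := fun t ht => hβF (mem_image_of_mem β ht)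
  have hδF' : ∀ t ∈ Icc (0 : ℝ) 1, δ t ∈ F' := fun t ht => hδF (mem_image_of_mem δ ht)
  let α : ℝ → Y := fun t => if t ≤ 1 then β t else δ (t - 1)
  have hα : Continuous α := by
    refine Continuous.if_le hβ (by fun_prop) continuous_id continuous_const fun t ht => ?_
    rw [ht, hβ1, sub_self, hδ0]
  have hcross : ∀ s ∈ Icc (0 : ℝ) 1, ∀ t ∈ Ioc (1 : ℝ) 2, β s ≠ δ (t - 1) := by
    intro s hs t ht hst
    have ht' : t - 1 ∈ Icc (0 : ℝ) 1 := ⟨by linarith [ht.1], by linarith [ht.2]⟩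
    have h1 : δ (t - 1) = δ 0 := (hFF ⟨hst ▸ hβF' s hs, hδF' _ ht'⟩ : δ (t - 1) = r).trans hδ0.symm
    have h2 := hδi ht' ⟨le_rfl, zero_le_one⟩ h1
    linarith [ht.1]
  have h0 : α 0 = x := by simp only [α, if_pos zero_le_one, hβ0]
  have h1 : α 1 = r := by simp only [α, if_pos le_rfl, hβ1]
  have h2 : α 2 = y := by
    have h : ¬ (2 : ℝ) ≤ 1 := by norm_num
    have h' : (2 : ℝ) - 1 = 1 := by norm_num
    simp only [α, if_neg h, h', hδ1]
  have hnj := hU.not_joinedIn hα (a := 0) (b := 2) (s₀ := 1) one_pos (by norm_num) ?_ ?_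
  · rwa [h0, h1, h2] at hnj
  · intro s hs t ht hst
    simp only [α] at hst
    split_ifs at hst with h3 h4 h4
    · exact hβi ⟨hs.1, h3⟩ ⟨ht.1, h4⟩ hst
    · exact (hcross s ⟨hs.1, h3⟩ t ⟨not_le.1 h4, ht.2⟩ hst).elim
    · exact (hcross t ⟨ht.1, h4⟩ s ⟨not_le.1 h3, hs.2⟩ hst.symm).elim
    · have := hδi ⟨by linarith, by linarith [hs.2]⟩ ⟨by linarith, by linarith [ht.2]⟩ hst
      linarith
  · intro s hs
    simp only [α]
    split_ifs with h
    · exact hF (hβF' s ⟨hs.1, h⟩)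
    · exact hF' (hδF' _ ⟨by linarith, by linarith [hs.2]⟩)

theorem JoinedIn.exists_first_hit {N K : Set Y} {y x : Y} (h : JoinedIn N y x) (hK : IsClosed K)
    (hx : x ∈ K) (hy : y ∉ K) : ∃ γ : ℝ → Y, Continuous γ ∧ ∃ t, 0 < t ∧ γ 0 = y ∧ γ t ∈ K ∩ N ∧
      ∀ s ∈ Ico 0 t, γ s ∈ N \ K := by
  let γ : ℝ → Y := h.somePath.extend
  have hγ : Continuous γ := h.somePath.continuous_extend
  have h0 : γ 0 = y := h.somePath.extend_zero
  have h1 : γ 1 = x := h.somePath.extend_one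
  have hN : ∀ t ∈ Icc (0 : ℝ) 1, γ t ∈ N := fun t ht => by
    simp only [γ, Path.extend_apply _ ht]
    exact h.somePath_mem _
  obtain ⟨t, ht⟩ := (isCompact_Icc.inter_right (hK.preimage hγ)).exists_isLeast
    (show (Icc (0 : ℝ) 1 ∩ γ ⁻¹' K).Nonempty from ⟨1, ⟨zero_le_one, le_rfl⟩, by
      rw [mem_preimage, h1]; exact hx⟩)
  refine ⟨γ, hγ, t, lt_of_le_of_ne ht.1.1.1 ?_, h0, ⟨ht.1.2, hN t ht.1.1⟩, fun s hs => ?_⟩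
  · rintro rfl
    exact hy (h0 ▸ ht.1.2)
  · have hs' : s ∈ Icc (0 : ℝ) 1 := ⟨hs.1, hs.2.le.trans ht.1.1.2⟩
    have hsK : γ s ∉ K := fun hsK => hs.2.not_ge (ht.2 ⟨hs', hsK⟩)
    exact ⟨hN s hs', hsK⟩

/-- If a subarc of an arc in a set without simple closed curves is not open, then there is a branch
at one of its points. -/
theorem NoCircle.exists_branch [LocallyPathConnectedSpace Y] {U : Set Y} (hU : NoCircle U)
    (hUo : IsOpen U) {α : ℝ → Y} (hα : Continuous α) (hi : InjOn α (Icc 0 1))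
    (hαU : MapsTo α (Icc 0 1) U) {u v : ℝ} (hu : 0 ≤ u) (hv : v ≤ 1)
    (hfree : ¬ IsOpen (α '' Ioo u v)) :
    ∃ s ∈ Ioo u v, ∃ B : Set Y, IsOpen B ∧ IsPathConnected B ∧ IsPathConnected (insert (α s) B) ∧
      B ⊆ U ∧ Disjoint B (α '' Icc 0 1) ∧ closure B ∩ U ⊆ insert (α s) B := by
  obtain ⟨x, ⟨s, hs, rfl⟩, hsn⟩ : ∃ x ∈ α '' Ioo u v, α '' Ioo u v ∉ 𝓝 x := by
    rw [isOpen_iff_mem_nhds] at hfree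
    push Not at hfree
    exact hfree
  have hs01 : s ∈ Icc (0 : ℝ) 1 := ⟨hu.trans hs.1.le, hs.2.le.trans hv⟩
  have hcl : ∀ a b, IsClosed (α '' Icc a b) := fun a b => (isCompact_Icc.image hα).isClosed
  set O : Set Y := U \ (α '' Icc 0 u ∪ α '' Icc v 1) with hO
  have hOo : IsOpen O := hUo.sdiff ((hcl _ _).union (hcl _ _))
  have hsO : α s ∈ O := by
    refine ⟨hαU hs01, ?_⟩
    rintro (⟨t, ht, hts⟩ | ⟨t, ht, hts⟩)
    · have := hi ⟨ht.1, ht.2.trans (hs.1.le.trans hs01.2)⟩ hs01 hts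
      linarith [ht.2, hs.1]
    · have := hi ⟨(hs01.1.trans hs.2.le).trans ht.1, ht.2⟩ hs01 hts
      linarith [ht.1, hs.2]
  have hOK : ∀ t ∈ Icc (0 : ℝ) 1, α t ∈ O → t ∈ Ioo u v := by
    intro t ht htO
    constructor
    · by_contra! h
      exact htO.2 (Or.inl ⟨t, ⟨ht.1, h⟩, rfl⟩)
    · by_contra! h
      exact htO.2 (Or.inr ⟨t, ⟨h, ht.2⟩, rfl⟩)
  obtain ⟨y, hyN, hy⟩ : ∃ y ∈ pathComponentIn O (α s), y ∉ α '' Ioo u v := by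
    by_contra! hcon
    exact hsn (mem_of_superset ((hOo.pathComponentIn _).mem_nhds (mem_pathComponentIn_self hsO)) hcon)
  have hyO : y ∈ O := pathComponentIn_subset hyN
  set K := α '' Icc 0 1 with hK
  have hyK : y ∉ K := by
    rintro ⟨t, ht, rfl⟩
    exact hy ⟨t, hOK t ht hyO, rfl⟩
  obtain ⟨γ, hγ, t₀, ht₀, hγ0, ⟨⟨s', hs', hs'r⟩, hγO⟩, hγN⟩ :=
    (show JoinedIn O y (α s) from (hyN : JoinedIn O (α s) y).symm).exists_first_hit
      (hcl 0 1) ⟨s, hs01, rfl⟩ hyK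
  have hs'' : s' ∈ Ioo u v := hOK s' hs' (by rwa [hs'r])
  set r := α s' with hr
  have hrK : r ∈ K := ⟨s', hs', rfl⟩
  have hyr : y ≠ r := by
    rintro h
    exact hyK (h ▸ hrK)
  have hyB : y ∈ U \ {r} := ⟨hyO.1, hyr⟩
  have hγB : ∀ t ∈ Ico 0 t₀, γ t ∈ pathComponentIn (U \ {r}) y := by
    intro t ht
    have hm : MapsTo γ (Icc 0 t) (U \ {r}) := fun a ha => by
      have h := hγN a ⟨ha.1, ha.2.trans_lt ht.2⟩
      exact ⟨h.1.1, fun h' => h.2 (h' ▸ hrK)⟩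
    have := joinedIn_of_mapsTo_Icc hγ hm ⟨le_rfl, ht.1⟩ ⟨ht.1, le_rfl⟩
    rwa [hγ0] at this
  have hBp : IsPathConnected (pathComponentIn (U \ {r}) y) := isPathConnected_pathComponentIn hyB
  have hBU : pathComponentIn (U \ {r}) y ⊆ U \ {r} := pathComponentIn_subset
  have hdis : Disjoint (pathComponentIn (U \ {r}) y) K := by
    rw [disjoint_left]
    rintro _ hB ⟨t, ht, rfl⟩
    have hne : r ≠ α t := fun h => (hBU hB).2 h.symm
    have h1 : JoinedIn (insert r (U \ K)) y r := by
      have hm : MapsTo γ (Icc 0 t₀) (insert r (U \ K)) := fun a ha => by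
        rcases ha.2.eq_or_lt with rfl | h
        · exact Or.inl hs'r.symm
        · have h := hγN a ⟨ha.1, h⟩
          exact Or.inr ⟨h.1.1, h.2⟩
      have := joinedIn_of_mapsTo_Icc hγ hm ⟨le_rfl, ht₀.le⟩ ⟨ht₀.le, le_rfl⟩
      rwa [hγ0, ← hs'r] at this
    have h2 : JoinedIn K r (α t) := joinedIn_of_mapsTo_Icc hα (mapsTo_image _ _) hs' ht
    refine hU.not_joinedIn_of_inter_subset (insert_subset (hαU hs') sdiff_subset)
      (image_subset_iff.2 hαU) h1 h2 hyr hne ?_ hB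
    rintro z ⟨rfl | hz, hz'⟩
    exacts [rfl, (hz.2 hz').elim]
  refine ⟨s', hs'', pathComponentIn (U \ {r}) y, (hUo.sdiff isClosed_singleton).pathComponentIn y,
    hBp, ?_, hBU.trans sdiff_subset, hdis, ?_⟩
  · have h1 : JoinedIn (insert r (pathComponentIn (U \ {r}) y)) y r := by
      have hm : MapsTo γ (Icc 0 t₀) (insert r (pathComponentIn (U \ {r}) y)) := fun a ha => by
        rcases ha.2.eq_or_lt with rfl | h
        · exact Or.inl hs'r.symm
        · exact Or.inr (hγB a ⟨ha.1, h⟩)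
      have := joinedIn_of_mapsTo_Icc hγ hm ⟨le_rfl, ht₀.le⟩ ⟨ht₀.le, le_rfl⟩
      rwa [hγ0, ← hs'r] at this
    refine ⟨y, Or.inr (mem_pathComponentIn_self hyB), ?_⟩
    rintro z (rfl | hz)
    · exact h1
    · exact (hBp.joinedIn _ (mem_pathComponentIn_self hyB) _ hz).mono (subset_insert _ _)
  · rintro z ⟨hz, hzU⟩
    by_cases hzr : z = r
    · exact Or.inl hzr
    have hzU' : z ∈ U \ {r} := ⟨hzU, hzr⟩
    obtain ⟨w, hw, hw'⟩ := mem_closure_iff_nhds.1 hz _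
      (((hUo.sdiff isClosed_singleton).pathComponentIn z).mem_nhds (mem_pathComponentIn_self hzU'))
    exact Or.inr ((hw' : JoinedIn (U \ {r}) y w).trans (hw : JoinedIn (U \ {r}) z w).symm)

/-- An arc no subarc of which is open carries two disjoint branches. -/
theorem exists_disjoint_branches [CompactSpace Y] [LocallyPathConnectedSpace Y] {ρ : ℝ}
    (hρ : 0 < ρ) (hnc : ∀ x : Y, NoCircle (Metric.ball x ρ)) {z : Y}
    {α : ℝ → Y} (hα : Continuous α) (hi : InjOn α (Icc 0 1))
    (hαU : MapsTo α (Icc 0 1) (Metric.ball z ρ))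
    (hfree : ∀ u v, 0 ≤ u → u < v → v ≤ 1 → ¬ IsOpen (α '' Ioo u v)) :
    ∃ s ∈ Icc (0 : ℝ) 1, ∃ s' ∈ Icc (0 : ℝ) 1, ∃ B B' : Set Y, IsOpen B ∧ IsConnected B ∧
      closure B ⊆ insert (α s) B ∧ α s ∉ B ∧ IsOpen B' ∧ IsConnected B' ∧
      closure B' ⊆ insert (α s') B' ∧ α s' ∉ B' ∧ Disjoint B B' := by
  have hu : ∀ i : ℕ, (1 : ℝ) / (i + 2) < 1 / (i + 1) := fun i =>
    one_div_lt_one_div_of_lt (by positivity) (by linarith)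
  have hv : ∀ i : ℕ, (1 : ℝ) / (i + 1) ≤ 1 := fun i => by
    rw [div_le_one (by positivity)]
    linarith [(Nat.cast_nonneg i : (0 : ℝ) ≤ i)]
  choose s hs B hBo hBp hrB hBU hBK hBcl using fun i : ℕ => (hnc z).exists_branch Metric.isOpen_ball hα
    hi hαU (u := 1 / (i + 2)) (v := 1 / (i + 1)) (by positivity) (hv i)
    (hfree _ _ (by positivity) (hu i) (hv i))
  have hs01 : ∀ i, s i ∈ Icc (0 : ℝ) 1 := fun i =>
    ⟨(by positivity : (0 : ℝ) ≤ 1 / (i + 2)).trans (hs i).1.le, (hs i).2.le.trans (hv i)⟩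
  have hslt : ∀ i j, i < j → s j < s i := fun i j hij => by
    refine ((hs j).2.trans_le (one_div_le_one_div_of_le (by positivity) ?_)).trans (hs i).1
    have : ((i + 1 : ℕ) : ℝ) ≤ j := Nat.cast_le.2 hij
    push_cast at this
    linarith
  have hrne : ∀ i j, i ≠ j → α (s i) ≠ α (s j) := fun i j hij h => by
    have := hi (hs01 i) (hs01 j) h
    rcases lt_or_gt_of_ne hij with h' | h'
    · exact (hslt i j h').ne' this
    · exact (hslt j i h').ne this
  have hnot : ∀ i j, α (s i) ∉ B j := fun i j h => disjoint_left.1 (hBK j) h ⟨_, hs01 i, rfl⟩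
  have hrU : ∀ i, α (s i) ∈ Metric.ball z ρ := fun i => hαU (hs01 i)
  have hdisj : ∀ i j, i ≠ j → Disjoint (B i) (B j) := by
    intro i j hij
    rw [disjoint_left]
    intro x hx hx'
    have hsub : insert (α (s j)) (B j) ⊆ B i := by
      refine (hrB j).isConnected.isPreconnected.subset_of_closure_inter_subset (hBo i)
        ⟨x, Or.inr hx', hx⟩ ?_
      rintro y ⟨hy, hy'⟩
      have hyU : y ∈ Metric.ball z ρ := by
        rcases hy' with rfl | hy'
        exacts [hrU j, hBU j hy']
      rcases hBcl i ⟨hy, hyU⟩ with rfl | h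
      · rcases hy' with h | h
        exacts [(hrne i j hij h).elim, (hnot i j h).elim]
      · exact h
    exact hnot j i (hsub (mem_insert _ _))
  obtain ⟨η, hη, hηU⟩ := (isCompact_Icc.image hα : IsCompact (α '' Icc 0 1)).exists_cthickening_subset_open
    Metric.isOpen_ball (image_subset_iff.2 hαU)
  have hfin : {i | ∃ x ∈ B i, η ≤ dist x (α (s i))}.Finite := by
    by_contra hinf
    let e := Set.Infinite.natEmbedding _ hinf
    choose x hx hxη using fun j => (e j).2
    obtain ⟨-, β, -, -, -, φ, hφ, h⟩ := exists_arc_of_forall_dist_ge hρ hnc hη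
      (G := fun j => insert (α (s (e j))) (B (e j))) (x := fun j => α (s (e j))) (y := x)
      (fun j => (hrB (e j)).joinedIn _ (mem_insert _ _) _ (Or.inr (hx j))) hxη
    have h0 := h 0 (show (0 : ℝ) ∈ Icc 0 1 from ⟨le_rfl, zero_le_one⟩)
    have h1 := h 1 (show (0 : ℝ) ∈ Icc 0 1 from ⟨le_rfl, zero_le_one⟩)
    have hne : ((e (φ 0) : ℕ)) ≠ (e (φ 1) : ℕ) := fun h =>
      (hφ zero_lt_one).ne (e.injective (Subtype.ext h))
    rcases h0 with h0 | h0 <;> rcases h1 with h1 | h1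
    · exact hrne _ _ hne (h0.symm.trans h1)
    · exact hnot _ _ (h0 ▸ h1)
    · exact hnot _ _ (h1 ▸ h0)
    · exact disjoint_left.1 (hdisj _ _ hne) h0 h1
  have hgood : ∀ i ∉ {i | ∃ x ∈ B i, η ≤ dist x (α (s i))}, closure (B i) ⊆ insert (α (s i)) (B i) := by
    intro i hgi x hx
    refine hBcl i ⟨hx, hηU (Metric.closedBall_subset_cthickening (mem_image_of_mem α (hs01 i)) η
      (closure_minimal (fun y hy => ?_) Metric.isClosed_closedBall hx))⟩
    rw [Metric.mem_closedBall]
    by_contra! h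
    exact hgi ⟨y, hy, h.le⟩
  obtain ⟨i, hgi, j, hgj, hij⟩ := hfin.infinite_compl.nontrivial
  exact ⟨s i, hs01 i, s j, hs01 j, B i, B j, hBo i, (hBp i).isConnected, hgood i hgi, hnot i i,
    hBo j, (hBp j).isConnected, hgood j hgj, hnot j j, hdisj i j hij⟩

end Branches

section FreeArc

variable {Y : Type*} [MetricSpace Y]

theorem isOpen_image_Ioo_of_subset {α : ℝ → Y} (hα : Continuous α) (hi : InjOn α (Icc 0 1))
    (ho : IsOpen (α '' Ioo 0 1)) {a b : ℝ} (ha : 0 ≤ a) (hb : b ≤ 1) :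
    IsOpen (α '' Ioo a b) := by
  have heq : α '' Ioo a b = α '' Ioo 0 1 \ (α '' Icc 0 a ∪ α '' Icc b 1) := by
    ext x
    constructor
    · rintro ⟨t, ht, rfl⟩
      have ht' : t ∈ Ioo (0 : ℝ) 1 := ⟨ha.trans_lt ht.1, ht.2.trans_le hb⟩
      refine ⟨⟨t, ht', rfl⟩, ?_⟩
      rintro (⟨s, hs, hst⟩ | ⟨s, hs, hst⟩)
      · have := hi ⟨hs.1, hs.2.trans (ht.1.le.trans ht'.2.le)⟩ ⟨ht'.1.le, ht'.2.le⟩ hst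
        linarith [hs.2, ht.1]
      · have := hi ⟨(ht'.1.le.trans ht.2.le).trans hs.1, hs.2⟩ ⟨ht'.1.le, ht'.2.le⟩ hst
        linarith [hs.1, ht.2]
    · rintro ⟨⟨t, ht, rfl⟩, hn⟩
      refine ⟨t, ⟨?_, ?_⟩, rfl⟩
      · by_contra! h
        exact hn (Or.inl ⟨t, ⟨ht.1.le, h⟩, rfl⟩)
      · by_contra! h
        exact hn (Or.inr ⟨t, ⟨h, ht.2.le⟩, rfl⟩)
  rw [heq]
  exact ho.sdiff ((isCompact_Icc.image hα).isClosed.union (isCompact_Icc.image hα).isClosed)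

/-- A homeomorphism without fixed points on a free arc, moving a point of this arc forward along
the arc, maps the right hand side of this point to the right hand side of its image. -/
theorem Homeomorph.exists_mapsTo_right {α : ℝ → Y} (hα : Continuous α) (hi : InjOn α (Icc 0 1))
    (ho : IsOpen (α '' Ioo 0 1)) {h : Y ≃ₜ Y} (hfix : ∀ s ∈ Ioo (0 : ℝ) 1, h (α s) ≠ α s)
    {s s' b : ℝ} (hs : 0 < s) (hss : s < s') (hs' : s' < b) (hb : b ≤ 1) (he : h (α s) = α s') :
    ∃ y, s < y ∧ ∀ q ∈ Icc s y, h (α q) ∈ α '' Icc s' b := by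
  by_contra! hcon
  have hI : Icc s s' ⊆ Icc 0 1 := Icc_subset_Icc hs.le (hs'.le.trans hb)
  have hcont : Continuous fun q => h (α q) := h.continuous.comp hα
  let C : Set (ℝ × ℝ) := (Icc s s' ×ˢ Icc s s') ∩ {p | h (α p.1) = α p.2 ∧ p.1 ≤ p.2}
  have hC : IsCompact C := by
    refine (isCompact_Icc.prod isCompact_Icc).inter_right (IsClosed.inter ?_ ?_)
    · exact isClosed_eq (by fun_prop) (by fun_prop)
    · exact isClosed_le continuous_fst continuous_snd
  have hstep : ∀ r l p p', r < l → 0 ≤ p → p' ≤ 1 → h (α r) ∈ α '' Ioo p p' →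
      ∃ d, r < d ∧ d ≤ l ∧ ∀ q ∈ Icc r d, h (α q) ∈ α '' Ioo p p' := by
    intro r l p p' hrl hp hp' hmem
    have hnhds := hcont.continuousAt.eventually
      ((isOpen_image_Ioo_of_subset hα hi ho hp hp').mem_nhds hmem)
    obtain ⟨d, hd, hd'⟩ := (mem_nhdsGE_iff_exists_Icc_subset).1
      (mem_nhdsWithin_of_mem_nhds hnhds)
    exact ⟨min d l, lt_min hd hrl, min_le_right _ _,
      fun q hq => hd' ⟨hq.1, hq.2.trans (min_le_left _ _)⟩⟩
  have hsub : Icc s s' ⊆ Prod.fst '' C := by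
    refine IsClosed.Icc_subset_of_forall_exists_gt
      ((hC.image continuous_fst).isClosed.inter isClosed_Icc)
      ⟨(s, s'), ⟨⟨⟨le_rfl, hss.le⟩, hss.le, le_rfl⟩, he, hss.le⟩, rfl⟩ ?_
    rintro _ ⟨⟨⟨r, e⟩, ⟨⟨hr, hee⟩, hre, hle⟩, rfl⟩, hr'⟩ y hy
    simp only at *
    rw [mem_Ioi] at hy
    have hr0 : 0 < r := hs.trans_le hr.1
    rcases hr.1.eq_or_lt with rfl | hsr
    · set m := (s + s') / 2 with hm
      obtain ⟨d, hd, hdl, hdq⟩ := hstep s (min y m) m b (lt_min hy (by linarith)) (by linarith) hb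
        (he ▸ ⟨s', ⟨by linarith, hs'⟩, rfl⟩)
      obtain ⟨q, hq, hqn⟩ := hcon d hd
      obtain ⟨p, hp, hpe⟩ := hdq q hq
      have hps : p < s' := by
        by_contra! hps
        exact hqn ⟨p, ⟨hps, hp.2.le⟩, hpe⟩
      have hqs : s < q := lt_of_le_of_ne hq.1 (by
        rintro rfl
        exact hqn ⟨s', ⟨le_rfl, hs'.le⟩, he.symm⟩)
      have hqm : q ≤ m := hq.2.trans (hdl.trans (min_le_right _ _))
      have hqy : q ≤ y := hq.2.trans (hdl.trans (min_le_left _ _))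
      exact ⟨q, ⟨(q, p), ⟨⟨⟨hqs.le, by linarith⟩, by linarith [hp.1], hps.le⟩, hpe.symm,
        by simp only; linarith [hp.1]⟩, rfl⟩, hqs, hqy⟩
    · have hres : r < e := lt_of_le_of_ne hle (by
        rintro rfl
        exact hfix r ⟨hr0, by linarith [hr'.2]⟩ hre)
      have hes : e < s' := lt_of_le_of_ne hee.2 (by
        rintro rfl
        exact hsr.ne' (hi (hI hr) (hI ⟨le_rfl, hss.le⟩) (h.injective (hre.trans he.symm))))
      set m := (r + e) / 2 with hm
      obtain ⟨d, hd, hdl, hdq⟩ := hstep r (min y m) m s' (lt_min hy (by linarith)) (by linarith)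
        (hs'.le.trans hb) (hre ▸ ⟨e, ⟨by linarith, hes⟩, rfl⟩)
      obtain ⟨p, hp, hpe⟩ := hdq d ⟨hd.le, le_rfl⟩
      have hqm : d ≤ m := hdl.trans (min_le_right _ _)
      exact ⟨d, ⟨(d, p), ⟨⟨⟨by linarith, by linarith⟩, by linarith [hp.1], hp.2.le⟩, hpe.symm,
        by simp only; linarith [hp.1]⟩, rfl⟩, hd, hdl.trans (min_le_left _ _)⟩
  obtain ⟨⟨r, e⟩, ⟨⟨-, hee⟩, hre, hle⟩, hr⟩ := hsub ⟨hss.le, le_rfl⟩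
  simp only at *
  subst hr
  obtain rfl : e = r := le_antisymm hee.2 hle
  exact hfix e ⟨hs.trans hss, hs'.trans_le hb⟩ hre

/-- A homeomorphism without fixed points on a free arc is orientation preserving along this arc. -/
theorem Homeomorph.image_union_image_mem_nhds {α : ℝ → Y} (hα : Continuous α)
    (hi : InjOn α (Icc 0 1)) (ho : IsOpen (α '' Ioo 0 1)) {h : Y ≃ₜ Y}
    (hfix : ∀ s ∈ Ioo (0 : ℝ) 1, h (α s) ≠ α s) {s s' a b : ℝ} (hs : 0 < s) (hsb : s < b)
    (hb : b ≤ 1) (ha : 0 ≤ a) (has : a < s') (hs' : s' < 1) (he : h (α s) = α s') :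
    α '' Icc a s' ∪ (fun t => h (α t)) '' Icc s b ∈ 𝓝 (α s') := by
  obtain ⟨y, hy, hy1, hcov⟩ : ∃ y, s' < y ∧ y ≤ 1 ∧ α '' Icc s' y ⊆ (fun t => h (α t)) '' Icc s b := by
    rcases lt_trichotomy s s' with hlt | rfl | hlt
    · obtain ⟨y, hy, hmem⟩ := h.exists_mapsTo_right hα hi ho hfix hs hlt hs' le_rfl he
      set d := min y b with hd
      have hsd : s < d := lt_min hy hsb
      have hd1 : d ≤ 1 := (min_le_right _ _).trans hb
      obtain ⟨e, hee, hed⟩ := hmem d ⟨hsd.le, min_le_left _ _⟩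
      have hse : s' < e := lt_of_le_of_ne hee.1 (by
        rintro rfl
        have := hi ⟨hs.le, hsd.le.trans hd1⟩ ⟨hs.le.trans hsd.le, hd1⟩
          (h.injective (he.trans hed))
        exact hsd.ne this)
      refine ⟨e, hse, hee.2, ?_⟩
      rintro _ ⟨p, hp, rfl⟩
      have hpc : IsPreconnected ((fun t => h (α t)) '' Icc s d) :=
        isPreconnected_Icc.image _ (h.continuous.comp hα).continuousOn
      have hcl : ∀ a b, IsClosed (α '' Icc a b) := fun a b => (isCompact_Icc.image hα).isClosed
      obtain ⟨_, ⟨q, hq, rfl⟩, ⟨c, hc, hc'⟩, ⟨c', hcc, hcc'⟩⟩ := isPreconnected_closed_iff.1 hpc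
        (α '' Icc s' p) (α '' Icc p 1) (hcl _ _) (hcl _ _) (by
          rintro _ ⟨q, hq, rfl⟩
          obtain ⟨c, hc, hcq⟩ := hmem q ⟨hq.1, hq.2.trans (min_le_left _ _)⟩
          simp only [← hcq]
          rcases le_total c p with h | h
          · exact Or.inl ⟨c, ⟨hc.1, h⟩, rfl⟩
          · exact Or.inr ⟨c, ⟨h, hc.2⟩, rfl⟩)
        ⟨α s', ⟨s, ⟨le_rfl, hsd.le⟩, he⟩, s', ⟨le_rfl, hp.1⟩, rfl⟩
        ⟨α e, ⟨d, ⟨hsd.le, le_rfl⟩, hed.symm⟩, e, ⟨hp.2, hee.2⟩, rfl⟩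
      have hp1 : p ≤ 1 := hp.2.trans hee.2
      have hs0 : 0 < s' := hs.trans hlt
      have hcc'' := hi ⟨hs0.le.trans hc.1, hc.2.trans hp1⟩ ⟨(hs0.le.trans hp.1).trans hcc.1, hcc.2⟩
        (hc'.trans hcc'.symm)
      have hcp : c = p := le_antisymm hc.2 (hcc.1.trans hcc''.ge)
      exact ⟨q, ⟨hq.1, hq.2.trans (min_le_right _ _)⟩, by rw [← hcp, hc']⟩
    · exact (hfix s ⟨hs, hs'⟩ he).elim
    · obtain ⟨y, hy, hmem⟩ := h⁻¹.exists_mapsTo_right hα hi ho (fun t ht heq => hfix t ht (by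
        conv_lhs => rw [← heq, h.apply_inv_self])) (ha.trans_lt has) hlt hsb hb
        (by rw [← he, h.inv_apply_self])
      refine ⟨min y 1, lt_min hy hs', min_le_right _ _, ?_⟩
      rintro _ ⟨p, hp, rfl⟩
      obtain ⟨q, hq, hqe⟩ := hmem p ⟨hp.1, hp.2.trans (min_le_left _ _)⟩
      exact ⟨q, hq, by simp only [hqe, h.apply_inv_self]⟩
  refine mem_of_superset ((isOpen_image_Ioo_of_subset hα hi ho ha hy1).mem_nhds
    ⟨s', ⟨has, hy⟩, rfl⟩) ?_
  rintro _ ⟨p, hp, rfl⟩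
  rcases le_total p s' with hle | hle
  · exact Or.inl ⟨p, ⟨hp.1.le, hle⟩, rfl⟩
  · exact Or.inr (hcov ⟨p, ⟨hle, hp.2.le⟩, rfl⟩)

/-- If a free arc without periodic points meets its image under a nonwandering homeomorphism, then
the space is covered by finitely many images of the arc. -/
theorem IsNonwandering.exists_cover_of_free_arc [PreconnectedSpace Y] {g : Y ≃ₜ Y}
    (hg : IsNonwandering g) {α : ℝ → Y} (hα : Continuous α) (hi : InjOn α (Icc 0 1))
    (ho : IsOpen (α '' Ioo 0 1)) (hper : ∀ s ∈ Ioo (0 : ℝ) 1, ∀ k, 1 ≤ k → (g ^ k) (α s) ≠ α s)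
    {t t' : ℝ} (ht : 0 < t) (htt : t < t') (ht' : t' < 1) (he : g (α t) = α t') :
    ∃ k, ∀ x, ∃ i ≤ k, ∃ s ∈ Icc (0 : ℝ) 1, (g ^ i) (α s) = x := by
  obtain ⟨k, hk, _, ⟨u', hu', rfl⟩, u, hu, hue⟩ := hg _
    (isOpen_image_Ioo_of_subset hα hi ho ht.le ht'.le) ((nonempty_Ioo.2 htt).image α)
  refine ⟨k, ?_⟩
  let lo : ℕ → ℝ := fun i => if i = 0 then u else t
  let hi' : ℕ → ℝ := fun i => if i = k then u' else t'
  have hlo : ∀ i, t ≤ lo i ∧ lo i < t' := fun i => by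
    simp only [lo]; split_ifs
    exacts [⟨hu.1.le, hu.2⟩, ⟨le_rfl, htt⟩]
  have hhi : ∀ i, t < hi' i ∧ hi' i ≤ t' := fun i => by
    simp only [hi']; split_ifs
    exacts [⟨hu'.1, hu'.2.le⟩, ⟨htt, le_rfl⟩]
  let D : ℕ → Set Y := fun i => (fun s => (g ^ i) (α s)) '' Icc (lo i) (hi' i)
  let A : Set Y := ⋃ i ∈ Finset.range (k + 1), D i
  have hD : ∀ i, i ≤ k → D i ⊆ A := fun i hik =>
    subset_biUnion_of_mem (u := D) (Finset.mem_coe.2 (Finset.mem_range.2 (Nat.lt_succ_of_le hik)))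
  have hAc : IsClosed A := isClosed_biUnion_finset fun i _ =>
    (isCompact_Icc.image ((g ^ i).continuous.comp hα)).isClosed
  have himg : ∀ (h : Y ≃ₜ Y) (S : Set Y) (x : Y), S ∈ 𝓝 x → h '' S ∈ 𝓝 (h x) :=
    fun h S x hS => h.isOpenMap.image_mem_nhds hS
  have hF1 : ∀ i < k, A ∈ 𝓝 ((g ^ i) (α t')) := by
    intro i hik
    refine mem_of_superset (himg (g ^ i) _ _ (g.image_union_image_mem_nhds hα hi ho
      (fun s hs => by simpa using hper s hs 1 le_rfl) ht (hhi (i + 1)).1 ((hhi (i + 1)).2.trans ht'.le)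
      (ht.le.trans (hlo i).1) (hlo i).2 ht' he)) ?_
    rw [image_union]
    refine union_subset ?_ ?_
    · rintro _ ⟨_, ⟨s, hs, rfl⟩, rfl⟩
      refine hD i hik.le ⟨s, ⟨hs.1, ?_⟩, rfl⟩
      simp only [hi', if_neg hik.ne]
      exact hs.2
    · rintro _ ⟨_, ⟨s, hs, rfl⟩, rfl⟩
      refine hD (i + 1) hik ⟨s, ⟨?_, hs.2⟩, ?_⟩
      · simp only [lo, if_neg i.succ_ne_zero]
        exact hs.1
      · simp only [g.pow_add_apply, pow_one]
  have hF2 : A ∈ 𝓝 (α u) := by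
    have h1 := (g ^ k)⁻¹.image_union_image_mem_nhds hα hi ho (fun s hs heq => hper s hs k hk (by
      conv_lhs => rw [← heq, (g ^ k).apply_inv_self])) (ht.trans hu.1) hu.2 ht'.le ht.le hu'.1
      (hu'.2.trans ht') (by rw [hue, (g ^ k).inv_apply_self])
    have h2 := himg (g ^ k) _ _ h1
    rw [← hue, image_union] at h2
    refine mem_of_superset h2 (union_subset ?_ ?_)
    · rintro _ ⟨_, ⟨s, hs, rfl⟩, rfl⟩
      refine hD k le_rfl ⟨s, ⟨?_, ?_⟩, rfl⟩
      · simp only [lo, if_neg (Nat.pos_iff_ne_zero.1 hk)]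
        exact hs.1
      · simp only [hi', if_pos rfl]
        exact hs.2
    · rintro _ ⟨_, ⟨s, hs, rfl⟩, rfl⟩
      refine hD 0 (Nat.zero_le _) ⟨s, ⟨hs.1, ?_⟩, ?_⟩
      · simp only [hi', if_neg (Nat.pos_iff_ne_zero.1 hk).symm]
        exact hs.2
      · simp only [pow_zero, (g ^ k).apply_inv_self]
        rfl
  have hAo : IsOpen A := by
    rw [isOpen_iff_mem_nhds]
    intro x hx
    obtain ⟨i, hik, p, hp, rfl⟩ : ∃ i, i ≤ k ∧ x ∈ D i := by
      simpa [A, Nat.lt_succ_iff] using hx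
    simp only
    rcases hp.1.eq_or_lt with h1 | h1
    · rcases Nat.eq_zero_or_pos i with rfl | hi0
      · rw [← h1]
        exact hF2
      · have hpt : p = t := by rw [← h1]; simp only [lo, if_neg hi0.ne']
        obtain ⟨j, rfl⟩ := Nat.exists_eq_succ_of_ne_zero hi0.ne'
        rw [hpt, Nat.succ_eq_add_one, g.pow_add_apply, pow_one, he]
        exact hF1 j hik
    rcases hp.2.eq_or_lt with h2 | h2
    · rcases hik.eq_or_lt with rfl | hik'
      · have hpu : p = u' := by rw [h2]; simp only [hi', if_pos rfl]
        rw [hpu, ← hue]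
        exact hF2
      · have hpt : p = t' := by rw [h2]; simp only [hi', if_neg hik'.ne]
        rw [hpt]
        exact hF1 i hik'
    · refine mem_of_superset (himg (g ^ i) _ _ ((isOpen_image_Ioo_of_subset hα hi ho
        (ht.le.trans (hlo i).1) ((hhi i).2.trans ht'.le)).mem_nhds ⟨p, ⟨h1, h2⟩, rfl⟩)) ?_
      rintro _ ⟨_, ⟨s, hs, rfl⟩, rfl⟩
      exact hD i hik ⟨s, ⟨hs.1.le, hs.2.le⟩, rfl⟩
  have hAu : A = univ := (isClopen_iff.1 ⟨hAc, hAo⟩).resolve_left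
    (Set.nonempty_iff_ne_empty.1 ⟨α u, mem_of_mem_nhds hF2⟩)
  intro x
  obtain ⟨i, hik, p, hp, hpx⟩ : ∃ i, i ≤ k ∧ x ∈ D i := by
    have : x ∈ A := hAu ▸ mem_univ x
    simpa [A, Nat.lt_succ_iff] using this
  exact ⟨i, hik, p, ⟨ht.le.trans ((hlo i).1.trans hp.1), hp.2.trans ((hhi i).2.trans ht'.le)⟩, hpx⟩

end FreeArc

section Equicontinuity

variable {Y : Type*} [MetricSpace Y]

theorem Homeomorph.exists_forall_le_dist_pow_lt [CompactSpace Y] (g : Y ≃ₜ Y) (k : ℕ) {η : ℝ}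
    (hη : 0 < η) :
    ∃ δ > 0, ∀ i ≤ k, ∀ x y, dist x y < δ → dist ((g ^ i) x) ((g ^ i) y) < η := by
  have h : ∀ i : ℕ, ∃ δ > 0, ∀ x y, dist x y < δ → dist ((g ^ i) x) ((g ^ i) y) < η := by
    intro i
    obtain ⟨δ, hδ, h⟩ := Metric.uniformContinuous_iff.1
      (CompactSpace.uniformContinuous_of_continuous (g ^ i).continuous) η hη
    exact ⟨δ, hδ, fun x y hxy => h hxy⟩
  choose δ hδ h using h
  refine ⟨(Finset.range (k + 1)).inf' ⟨0, by simp⟩ δ,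
    (Finset.lt_inf'_iff _).2 fun i _ => hδ i, fun i hi x y hxy => h i x y (hxy.trans_le ?_)⟩
  exact Finset.inf'_le _ (by simpa using Nat.lt_succ_of_le hi)

/-- The backward images of the arc `α` under `f` have arbitrarily small diameter. -/
def ShrinksBackward (f : Y ≃ₜ Y) (α : ℝ → Y) : Prop :=
  ∀ ε > 0, ∃ n : ℕ, ∀ s ∈ Icc (0 : ℝ) 1, ∀ t ∈ Icc (0 : ℝ) 1,
    dist ((f⁻¹ ^ n) (α s)) ((f⁻¹ ^ n) (α t)) < ε

theorem ShrinksBackward.false_of_cover [CompactSpace Y] {f g : Y ≃ₜ Y} {α : ℝ → Y}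
    (h : ShrinksBackward f α) (hfg : Commute f g) (hi : InjOn α (Icc 0 1)) {k : ℕ}
    (hcov : ∀ x, ∃ i ≤ k, ∃ s ∈ Icc (0 : ℝ) 1, (g ^ i) (α s) = x) : False := by
  have hinf : (α '' Icc 0 1).Infinite := (Icc_infinite zero_lt_one).image hi
  obtain ⟨S, -, hS⟩ := hinf.exists_subset_card_eq (k + 2)
  obtain ⟨η, hη, hsep⟩ : ∃ η > 0, ∀ x ∈ S, ∀ y ∈ S, dist x y < η → x = y := by
    have h1 : ∀ᶠ η : ℝ in 𝓝[>] 0, ∀ x ∈ S, ∀ y ∈ S, dist x y < η → x = y := by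
      refine (Finset.eventually_all S).2 fun x _ => (Finset.eventually_all S).2 fun y _ => ?_
      rcases eq_or_ne x y with rfl | hne
      · exact Eventually.of_forall fun _ _ => rfl
      · filter_upwards [nhdsWithin_le_nhds (Iio_mem_nhds (dist_pos.2 hne))] with η hη hlt
        exact absurd hη (not_lt.2 hlt.le)
    obtain ⟨η, h, hη⟩ := (h1.and self_mem_nhdsWithin).exists
    exact ⟨η, hη, h⟩
  obtain ⟨δ, hδ, huc⟩ := g.exists_forall_le_dist_pow_lt k hη
  obtain ⟨n, hn⟩ := h δ hδ
  have hrep : ∀ x, ∃ i ≤ k, ∃ s ∈ Icc (0 : ℝ) 1, (g ^ i) ((f⁻¹ ^ n) (α s)) = x := by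
    intro x
    obtain ⟨i, hik, s, hs, he⟩ := hcov ((f ^ n) x)
    refine ⟨i, hik, s, hs, ?_⟩
    have hc : Commute (g ^ i) (f⁻¹ ^ n) := (hfg.inv_left.pow_pow n i).symm
    have h2 : (g ^ i) ((f⁻¹ ^ n) (α s)) = (f⁻¹ ^ n) ((g ^ i) (α s)) :=
      DFunLike.congr_fun hc.eq (α s)
    rw [h2, he, f.inv_pow_pow_apply]
  choose i hik s hs he using hrep
  obtain ⟨x, hx, y, hy, hxy, hixy⟩ := Finset.exists_ne_map_eq_of_card_lt_of_maps_to
    (t := Finset.range (k + 1)) (f := i) (s := S) (by simp [hS])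
    (fun x _ => by simpa using Nat.lt_succ_of_le (hik x))
  refine hxy (hsep x hx y hy ?_)
  rw [← he x, ← he y, ← hixy]
  exact huc _ (hik x) _ _ (hn _ (hs x) _ (hs y))

/-- A backward shrinking arc contains at most one periodic point. -/
theorem ShrinksBackward.eq_of_periodic [CompactSpace Y] {f : Y ≃ₜ Y} {α : ℝ → Y}
    (h : ShrinksBackward f α) {s t : ℝ} (hs : s ∈ Icc (0 : ℝ) 1) (ht : t ∈ Icc (0 : ℝ) 1) {p q : ℕ}
    (hp : 1 ≤ p) (hq : 1 ≤ q) (hps : (f ^ p) (α s) = α s) (hqt : (f ^ q) (α t) = α t) :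
    α s = α t := by
  have hper : ∀ (p : ℕ) (x : Y), (f ^ p) x = x → ∀ n : ℕ, (f ^ (p * n)) x = x := by
    intro p x hx n
    rw [f.pow_mul_apply, Homeomorph.coe_pow_eq_iterate]
    exact Function.IsFixedPt.iterate hx n
  have hback : ∀ (x : Y), (f ^ (p * q)) x = x → ∀ n : ℕ,
      (f ^ (n % (p * q))) ((f⁻¹ ^ n) x) = x := by
    intro x hx n
    have h1 : (f⁻¹ ^ n) x = (f⁻¹ ^ n) ((f ^ (p * q * (n / (p * q)))) x) := by rw [hper _ _ hx]
    have h2 : (f ^ (n % (p * q))) ((f⁻¹ ^ n) x) = (f⁻¹ ^ n) ((f ^ (n % (p * q))) x) :=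
      DFunLike.congr_fun ((Commute.refl f).inv_right.pow_pow (n % (p * q)) n).eq x
    rw [h2]
    conv_lhs => rw [← hper _ _ hx (n / (p * q))]
    rw [← f.pow_add_apply, Nat.mod_add_div, f.inv_pow_pow_apply]
  have hs' : (f ^ (p * q)) (α s) = α s := hper _ _ hps q
  have ht' : (f ^ (p * q)) (α t) = α t := by rw [mul_comm]; exact hper _ _ hqt p
  rw [← dist_le_zero]
  refine le_of_forall_pos_lt_add fun η hη => ?_
  rw [zero_add]
  obtain ⟨δ, hδ, huc⟩ := f.exists_forall_le_dist_pow_lt (p * q) hη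
  obtain ⟨n, hn⟩ := h δ hδ
  have := huc (n % (p * q)) (Nat.mod_lt _ (Nat.mul_pos hp hq)).le _ _ (hn s hs t ht)
  rwa [hback _ hs', hback _ ht'] at this

theorem ShrinksBackward.false_of_isOpen [PreconnectedSpace Y] [CompactSpace Y] {f : Y ≃ₜ Y}
    (hf : IsNonwandering f) {α : ℝ → Y} (h : ShrinksBackward f α) (hα : Continuous α)
    (hi : InjOn α (Icc 0 1)) (ho : IsOpen (α '' Ioo 0 1))
    (hper : ∀ s ∈ Icc (0 : ℝ) 1, ∀ k, 1 ≤ k → (f ^ k) (α s) ≠ α s) : False := by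
  obtain ⟨m, hm, _, ⟨t, ht, rfl⟩, t', ht', he⟩ := hf _ ho ((nonempty_Ioo.2 zero_lt_one).image α)
  have hperm : ∀ s ∈ Ioo (0 : ℝ) 1, ∀ k, 1 ≤ k → ((f ^ m) ^ k) (α s) ≠ α s := by
    intro s hs k hk
    rw [← f.pow_mul_apply]
    exact hper s (Ioo_subset_Icc_self hs) _ (Nat.mul_pos hm hk)
  rcases lt_trichotomy t t' with hlt | rfl | hlt
  · obtain ⟨k, hk⟩ := (hf.pow hm).exists_cover_of_free_arc hα hi ho hperm ht.1 hlt ht'.2 he.symm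
    exact h.false_of_cover ((Commute.refl f).pow_right m) hi hk
  · exact hper t (Ioo_subset_Icc_self ht) m hm he.symm
  · obtain ⟨k, hk⟩ := (hf.pow hm).inv.exists_cover_of_free_arc hα hi ho (fun s hs k hk heq =>
      hperm s hs k hk (by conv_lhs => rw [← heq, Homeomorph.pow_inv_pow_apply])) ht'.1 hlt ht.2
      (by rw [he, Homeomorph.inv_apply_self])
    exact h.false_of_cover ((Commute.refl f).pow_right m).inv_right hi hk

theorem mapsTo_affine_Icc {a b : ℝ} (ha : 0 ≤ a) (hab : a < b) (hb : b ≤ 1) :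
    MapsTo (fun t => a + t * (b - a)) (Icc 0 1) (Icc 0 1) := by
  rintro t ⟨h0, h1⟩
  constructor <;> nlinarith

theorem injOn_comp_affine {Y : Type*} {α : ℝ → Y} (hi : InjOn α (Icc 0 1)) {a b : ℝ} (ha : 0 ≤ a) (hab : a < b)
    (hb : b ≤ 1) : InjOn (fun t => α (a + t * (b - a))) (Icc 0 1) := by
  refine hi.comp (fun s _ t _ h => ?_) (mapsTo_affine_Icc ha hab hb)
  have : b - a ≠ 0 := (sub_pos.2 hab).ne'
  simpa [this] using h

theorem image_affine_Ioo {a b : ℝ} (hab : a < b) :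
    (fun t => a + t * (b - a)) '' Ioo 0 1 = Ioo a b := by
  have hba := sub_pos.2 hab
  have h : (fun t => a + t * (b - a)) = fun t => (b - a) * t + a := by ext; ring
  rw [h, Set.image_affine_Ioo hba]
  simp

theorem ShrinksBackward.comp_affine {f : Y ≃ₜ Y} {α : ℝ → Y} (h : ShrinksBackward f α) {a b : ℝ}
    (ha : 0 ≤ a) (hab : a < b) (hb : b ≤ 1) :
    ShrinksBackward f (fun t => α (a + t * (b - a))) := by
  intro ε hε
  obtain ⟨n, hn⟩ := h ε hε
  exact ⟨n, fun s hs t ht => hn _ (mapsTo_affine_Icc ha hab hb hs) _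
    (mapsTo_affine_Icc ha hab hb ht)⟩

theorem ShrinksBackward.exists_nonperiodic [CompactSpace Y] {f : Y ≃ₜ Y} {α : ℝ → Y}
    (h : ShrinksBackward f α) (hi : InjOn α (Icc 0 1)) :
    ∃ a b : ℝ, 0 ≤ a ∧ a < b ∧ b ≤ 1 ∧
      ∀ s ∈ Icc (0 : ℝ) 1, ∀ k, 1 ≤ k → (f ^ k) (α (a + s * (b - a))) ≠ α (a + s * (b - a)) := by
  by_cases hex : ∃ s ∈ Icc (0 : ℝ) (1 / 3), ∃ k, 1 ≤ k ∧ (f ^ k) (α s) = α s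
  · obtain ⟨s, hs, k, hk, hks⟩ := hex
    refine ⟨2 / 3, 1, by norm_num, by norm_num, le_rfl, fun t ht m hm hmt => ?_⟩
    have hs1 : s ∈ Icc (0 : ℝ) 1 := ⟨hs.1, by linarith [hs.2]⟩
    have ht1 := mapsTo_affine_Icc (by norm_num : (0 : ℝ) ≤ 2 / 3) (by norm_num) le_rfl ht
    have := hi hs1 ht1 (h.eq_of_periodic hs1 ht1 hk hm hks hmt)
    simp only at this
    linarith [hs.2, ht.1]
  · push Not at hex
    refine ⟨0, 1 / 3, le_rfl, by norm_num, by norm_num, fun t ht m hm => hex _ ⟨?_, ?_⟩ m hm⟩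
    · linarith [ht.1]
    · linarith [ht.2]

theorem IsNonwandering.not_shrinksBackward [CompactSpace Y] [PreconnectedSpace Y]
    [LocallyPathConnectedSpace Y] {f : Y ≃ₜ Y} (hf : IsNonwandering f) {ρ : ℝ} (hρ : 0 < ρ)
    (hnc : ∀ x : Y, NoCircle (Metric.ball x ρ)) {z : Y} {α : ℝ → Y} (hα : Continuous α)
    (hi : InjOn α (Icc 0 1)) (hαU : MapsTo α (Icc 0 1) (Metric.ball z ρ)) :
    ¬ ShrinksBackward f α := by
  intro h
  obtain ⟨a, b, ha, hab, hb, hper⟩ := h.exists_nonperiodic hi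
  replace h := h.comp_affine ha hab hb
  replace hi := injOn_comp_affine hi ha hab hb
  replace hαU := hαU.comp (mapsTo_affine_Icc ha hab hb)
  have hβ : Continuous fun t => α (a + t * (b - a)) := by fun_prop
  by_cases hex : ∃ u v, 0 ≤ u ∧ u < v ∧ v ≤ 1 ∧
      IsOpen ((fun t => α (a + t * (b - a))) '' Ioo u v)
  · obtain ⟨u, v, hu, huv, hv, ho⟩ := hex
    refine (h.comp_affine hu huv hv).false_of_isOpen hf (by fun_prop)
      (injOn_comp_affine hi hu huv hv) ?_ fun s hs => hper _ (mapsTo_affine_Icc hu huv hv hs)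
    rw [← image_affine_Ioo huv, image_image] at ho
    exact ho
  · push Not at hex
    obtain ⟨s, hs, s', hs', B, B', hB, hBc, hBr, hr, hB', hBc', hBr', hr', hd⟩ :=
      exists_disjoint_branches hρ hnc hβ hi hαU hex
    exact hf.false_of_disjoint_branches hB hBc hBr hr (hper s hs) hB' hBc' hBr' hr' (hper s' hs') hd

theorem IsNonwandering.equicontinuous [CompactSpace Y] [PreconnectedSpace Y]
    [LocallyPathConnectedSpace Y] [LocallyConnectedSpace Y] {f : Y ≃ₜ Y} (hf : IsNonwandering f)
    {ρ : ℝ} (hρ : 0 < ρ) (hnc : ∀ x : Y, NoCircle (Metric.ball x ρ)) {ε : ℝ} (hε : 0 < ε) :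
    ∃ δ > 0, ∀ (n : ℕ) (x y : Y), dist x y < δ → dist ((f ^ n) x) ((f ^ n) y) < ε := by
  by_contra! hcon
  have hpos : ∀ j : ℕ, (0 : ℝ) < 1 / (j + 1) := fun j => Nat.one_div_pos_of_nat
  choose δ hδ hδj using fun j : ℕ => exists_forall_dist_lt_joinedIn (X := Y) (hpos j)
  choose n x y hxy hfar using fun j => hcon (δ j) (hδ j)
  obtain ⟨z, α, hα, hi, hαU, φ, hφ, hG⟩ := exists_arc_of_forall_dist_ge hρ hnc hε
    (G := fun j => (f ^ n j) '' Metric.ball (x j) (1 / (j + 1)))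
    (x := fun j => (f ^ n j) (x j)) (y := fun j => (f ^ n j) (y j))
    (fun j => JoinedIn.map (hδj j _ _ (hxy j)) (f ^ n j).continuous) (fun j => by
      rw [dist_comm]; exact hfar j)
  refine hf.not_shrinksBackward hρ hnc hα hi hαU fun η hη => ?_
  obtain ⟨j, hj⟩ := exists_nat_one_div_lt (half_pos hη)
  refine ⟨n (φ j), fun s hs t ht => ?_⟩
  obtain ⟨u, hu, hus⟩ := hG j hs
  obtain ⟨v, hv, hvt⟩ := hG j ht
  rw [← hus, ← hvt, f.inv_pow_pow_apply, f.inv_pow_pow_apply]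
  have hle : (1 : ℝ) / (φ j + 1) ≤ 1 / (j + 1) :=
    one_div_le_one_div_of_le (by positivity) (by exact_mod_cast Nat.succ_le_succ (hφ.le_apply))
  have h1 := dist_triangle_right u v (x (φ j))
  rw [Metric.mem_ball] at hu hv
  linarith

end Equicontinuity

/-- for a homeomorphism `f` without wandering points on a local dendrite, the
induced map `2^f` on the hyperspace of nonempty closed subsets satisfies `h_pol(2^f) = 0`. -/
theorem hpol_hyperMap_eq_zero_of_isLocalDendrite_of_no_wandering
    {X : Type*} [MetricSpace X] [CompactSpace X] [ConnectedSpace X] [Nonempty X]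
    (hX : IsLocalDendrite X) (f : X → X) (hf : IsHomeomorph f)
    (hw : ∀ p : X, ¬ IsWanderingPoint f p) :
    hpol (hyperMap f hf.continuous) = 0 := by
  have := hX.locallyConnectedSpace
  have : LocallyPathConnectedSpace X := locallyPathConnectedSpace_of_locallyConnectedSpace
  obtain ⟨ρ, hρ, hnc⟩ := hX.exists_noCircle_ball
  refine hpol_hyperMap_eq_zero_of_equicontinuous hf.continuous fun ε hε => ?_
  obtain ⟨δ, hδ, h⟩ := (isNonwandering_homeomorph hf hw).equicontinuous hρ hnc hε
  refine ⟨δ, hδ, fun n x y hxy => ?_⟩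
  have := h n x y hxy
  rwa [Homeomorph.coe_pow_eq_iterate] at this
end

section
/- Let X be a regular curve and f : X → X a homeomorphism. Then the topological entropy of f equals 0. -/
open Filter Topology TopologicalSpace Set
open scoped ENNReal NNReal

variable {X : Type*}

/-- The regularity condition for a regular curve: every point has arbitrarily small open
neighbourhoods with finite topological boundary. (The requirement that `X` be a continuum,
i.e. a nonempty compact connected metric space, is imposed via instance arguments.) -/
def IsRegularCurve (X : Type*) [TopologicalSpace X] : Prop :=
  ∀ x : X, ∀ U : Set X, IsOpen U → x ∈ U →
    ∃ V : Set X, IsOpen V ∧ x ∈ V ∧ V ⊆ U ∧ (frontier V).Finite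

/-- Topological entropy: `lim_{ε → 0⁺} limsup_{n → ∞} (1/n) log sep(n,ε)`; since the inner
quantity is antitone in `ε`, the limit as `ε → 0⁺` equals the supremum over `ε > 0`. -/
noncomputable def htop [PseudoMetricSpace X] (f : X → X) : ℝ≥0∞ :=
  ⨆ (ε : ℝ) (_ : 0 < ε), Filter.atTop.limsup fun n =>
    if sepCount f n ε = ⊤ then ⊤
    else ENNReal.ofReal (Real.log (((sepCount f n ε).toNat : ℝ)) / n)

/-- A set obtained by intersecting pullbacks, along the first `n` iterates, of sets with boundary
in `F` is either everything or has a boundary point, which lies in the pullback of `F`. Hence the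
first `n` pullbacks of `F`, together with any point, follow every orbit segment closely. -/
theorem exists_dist_iterate_le [MetricSpace X] [ConnectedSpace X] {f : X → X} (hf : Continuous f)
    {r : ℝ} {V : X → Set X} (hV : ∀ c, IsOpen (V c)) (hVr : ∀ c, V c ⊆ Metric.ball c r)
    {t : Set X} (ht : ∀ x, ∃ c ∈ t, x ∈ V c) {F : Set X} (hF : ∀ c ∈ t, frontier (V c) ⊆ F)
    (x₀ : X) (n : ℕ) (x : X) :
    ∃ z, (z = x₀ ∨ ∃ k < n, f^[k] z ∈ F) ∧ ∀ k < n, dist (f^[k] x) (f^[k] z) ≤ 2 * r := by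
  choose c hct hc using fun k => ht (f^[k] x)
  set A : Set X := ⋂ k ∈ Finset.range n, f^[k] ⁻¹' V (c k) with hA
  have hxA : x ∈ A := by simp [hA, hc]
  have hdist : ∀ z ∈ closure A, ∀ k < n, dist (f^[k] x) (f^[k] z) ≤ 2 * r := by
    intro z hz k hk
    have hAk : A ⊆ f^[k] ⁻¹' V (c k) := biInter_subset_of_mem (by simpa using hk)
    have h₁ : f^[k] z ∈ closure (V (c k)) :=
      (hf.iterate k).closure_preimage_subset _ (closure_mono hAk hz)
    have h₂ : f^[k] z ∈ Metric.closedBall (c k) r :=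
      Metric.closure_ball_subset_closedBall (closure_mono (hVr _) h₁)
    have h₃ := Metric.mem_ball.1 (hVr _ (hc k))
    rw [Metric.mem_closedBall] at h₂
    linarith [dist_triangle_right (f^[k] x) (f^[k] z) (c k)]
  by_cases h : A = univ
  · exact ⟨x₀, Or.inl rfl, hdist x₀ (by simp [h])⟩
  · have hAo : IsOpen A := isOpen_biInter_finset fun k _ => (hV _).preimage (hf.iterate k)
    obtain ⟨z, hz⟩ : (frontier A).Nonempty := by
      rw [nonempty_iff_ne_empty, Ne, ← isClopen_iff_frontier_eq_empty, isClopen_iff]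
      rintro (h' | h')
      · simp [h'] at hxA
      · exact h h'
    refine ⟨z, Or.inr ?_, hdist z (frontier_subset_closure hz)⟩
    have hzA : z ∉ A := by
      rw [hAo.frontier_eq] at hz
      exact hz.2
    obtain ⟨k, hk, hzk⟩ : ∃ k < n, f^[k] z ∉ V (c k) := by simpa [hA] using hzA
    refine ⟨k, hk, hF (c k) (hct k) ?_⟩
    rw [(hV _).frontier_eq]
    have hAk : A ⊆ f^[k] ⁻¹' V (c k) := biInter_subset_of_mem (by simpa using hk)
    exact ⟨(hf.iterate k).closure_preimage_subset _
      (closure_mono hAk (frontier_subset_closure hz)), hzk⟩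

/-- For an injective continuous self-map of a regular curve, `sep(n, ε)` grows at most linearly. -/
theorem exists_sepCount_le [MetricSpace X] [CompactSpace X] [ConnectedSpace X]
    (hX : IsRegularCurve X) {f : X → X} (hf : Continuous f) (hinj : Function.Injective f)
    {ε : ℝ} (hε : 0 < ε) : ∃ M : ℕ, ∀ n, sepCount f n ε ≤ ((n * M + 1 : ℕ) : ℕ∞) := by
  classical
  obtain ⟨x₀⟩ := (inferInstance : Nonempty X)
  have hr : 0 < ε / 5 := by positivity
  choose V hV hxV hVr hfr using fun x =>
    hX x (Metric.ball x (ε / 5)) Metric.isOpen_ball (Metric.mem_ball_self hr)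
  obtain ⟨t, ht⟩ := CompactSpace.elim_nhds_subcover V fun x => (hV x).mem_nhds (hxV x)
  have htx : ∀ x, ∃ c ∈ (t : Set X), x ∈ V c := fun x => by
    have : x ∈ ⋃ c ∈ t, V c := ht ▸ mem_univ x
    simpa using this
  let F : Finset X := t.biUnion fun c => (hfr c).toFinset
  have hF : ∀ c ∈ (t : Set X), frontier (V c) ⊆ F := fun c hc y hy => by
    simpa [F] using ⟨c, hc, hy⟩
  refine ⟨F.card, fun n => iSup₂_le fun E hE => ?_⟩
  choose φ hφ hd using exists_dist_iterate_le hf hV hVr htx hF x₀ n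
  let S : Finset X := insert x₀
    ((Finset.range n).biUnion fun k => F.preimage f^[k] (hinj.iterate k).injOn)
  have hS : S.card ≤ n * F.card + 1 := by
    refine (Finset.card_insert_le _ _).trans (Nat.add_le_add_right ?_ 1)
    refine (Finset.card_biUnion_le_card_mul _ _ F.card fun k _ => ?_).trans (by simp)
    exact Finset.card_le_card_of_injOn f^[k] (fun y hy => by simpa using hy)
      (hinj.iterate k).injOn
  have hES : E.card ≤ S.card := by
    refine Finset.card_le_card_of_injOn φ (fun x _ => ?_) fun x hx y hy hxy => ?_
    · simpa [S] using hφ x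
    · by_contra hne
      have h₁ := hE x hx y hy hne
      have h₂ : dynDist f n x y ≤ 4 * (ε / 5) := by
        rw [dynDist, ← Real.le_toNNReal_iff_coe_le (by positivity)]
        refine Finset.sup_le fun k hk => NNReal.le_toNNReal_of_coe_le ?_
        rw [Finset.mem_range] at hk
        rw [coe_nndist]
        have hx' := hd x k hk
        have hy' := hd y k hk
        rw [hxy] at hx'
        linarith [dist_triangle_right (f^[k] x) (f^[k] y) (f^[k] (φ y))]
      linarith
  exact_mod_cast hES.trans hS

/-- A sequence of linear growth has exponential growth rate `0`. -/
theorem limsup_log_div_eq_zero_of_le_linear {u : ℕ → ℕ∞} {M : ℕ}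
    (hu : ∀ n, u n ≤ ((n * M + 1 : ℕ) : ℕ∞)) :
    Filter.atTop.limsup (fun n : ℕ => if u n = ⊤ then (⊤ : ℝ≥0∞)
      else ENNReal.ofReal (Real.log ((u n).toNat : ℝ) / n)) = 0 := by
  have hlim : Tendsto (fun n : ℕ => Real.log n / n + Real.log (M + 1) / n) atTop (𝓝 0) := by
    have h₁ : Tendsto (fun n : ℕ => Real.log n / n) atTop (𝓝 0) :=
      Real.isLittleO_log_id_atTop.tendsto_div_nhds_zero.comp tendsto_natCast_atTop_atTop
    simpa using h₁.add (tendsto_const_div_atTop_nhds_zero_nat (Real.log (M + 1)))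
  have hlim' := ENNReal.tendsto_ofReal hlim
  rw [ENNReal.ofReal_zero] at hlim'
  refine (tendsto_of_tendsto_of_tendsto_of_le_of_le' tendsto_const_nhds hlim'
    (Eventually.of_forall fun _ => zero_le) ?_).limsup_eq
  filter_upwards [eventually_ge_atTop 1] with n hn
  have htop : u n ≠ ⊤ := ne_top_of_le_ne_top (ENat.natCast_ne_top _) (hu n)
  rw [if_neg htop]
  apply ENNReal.ofReal_le_ofReal
  rw [← add_div]
  have hn' : (1 : ℝ) ≤ n := by exact_mod_cast hn
  have hM : (0 : ℝ) ≤ M := Nat.cast_nonneg M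
  gcongr
  rw [← Real.log_mul (by positivity) (by positivity)]
  rcases Nat.eq_zero_or_pos (u n).toNat with h0 | hpos
  · rw [h0, Nat.cast_zero, Real.log_zero]
    exact Real.log_nonneg (by nlinarith)
  · have hle : (u n).toNat ≤ n * M + 1 := ENat.toNat_le_of_le_natCast (hu n)
    have hle' : ((u n).toNat : ℝ) ≤ n * M + 1 := by exact_mod_cast hle
    exact Real.log_le_log (by exact_mod_cast hpos) (by linarith)

/-- a homeomorphism of a regular curve has topological entropy `0`. -/
theorem htop_eq_zero_of_isHomeomorph_of_isRegularCurve
    {X : Type*} [MetricSpace X] [CompactSpace X] [ConnectedSpace X] [Nonempty X]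
    (hX : IsRegularCurve X) (f : X → X) (hf : IsHomeomorph f) :
    htop f = 0 := by
  simp only [htop, ENNReal.iSup_eq_zero]
  intro ε hε
  obtain ⟨M, hM⟩ := exists_sepCount_le hX hf.continuous hf.injective hε
  exact limsup_log_div_eq_zero_of_le_linear hM
end
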